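/- arXiv:2112.04547 — 3 statements merged into one kernel-verified Lean document; each statement's English description precedes it below -/
import Mathlib

section
/- (Integral representation of the generalized Bessel function of type B₂.) Let κ₁,κ₂ > 0, set k = κ₂ and μ = κ₁ + κ₂ + 1/2, and let x₁,x₂,y₁,y₂ ≥ 0. Define the B₂ Bessel-type function by the convergent double series J(x,y) = Σ_{ℓ=0}^∞ Σ_{m=0}^∞ [ (x₁²x₂²y₁²y₂²/16)^ℓ / ((μ−k)_ℓ (μ)_ℓ ℓ! (μ+ℓ)_m (k+1+m)_ℓ m!) ] · P_{m,0}(x₁²/2, x₂²/2) P_{m,0}(y₁²/2, y₂²/2) / P_{m,0}(1,1), where (a)_n = Γ(a+n)/Γ(a). Then J(x,y) = c_κ ∫_{−1}^{1}∫_{−1}^{1} 𝓘_{μ−1}(√(Z(u,v)/2)) (1−u²)^{κ₂−1} (1−v²)^{κ₁−1} du dv, where Z(u,v) = (x₁²+x₂²)(y₁²+y₂²) + u(x₁²−x₂²)(y₁²−y₂²) + 4v x₁x₂y₁y₂ and c_κ = Γ(κ₁+1/2)Γ(κ₂+1/2)/(π Γ(κ₁)Γ(κ₂)). -/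
open Real

/-- Integral representation of the two-variable Jack polynomial `P_{(m+ℓ, ℓ)}`
with parameter `k > 0`. -/
noncomputable def JackP (k : ℝ) (m ℓ : ℕ) (x₁ x₂ : ℝ) : ℝ :=
  (Real.Gamma (m + 2 * k) / ((2 : ℝ) ^ (2 * k - 1) * Real.Gamma k * Real.Gamma (m + k))) *
    ((x₁ * x₂) ^ ℓ *
      ∫ u in (-1 : ℝ)..1, ((x₁ + x₂) / 2 + u * (x₁ - x₂) / 2) ^ m * (1 - u ^ 2) ^ (k - 1))

/-- The Laplace–Beltrami-type operator `Λ_k`. -/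
noncomputable def Lam (k : ℝ) (f : ℝ → ℝ → ℝ) (x₁ x₂ : ℝ) : ℝ :=
  x₁ ^ 2 * deriv (deriv (fun s => f s x₂)) x₁ +
    x₂ ^ 2 * deriv (deriv (fun s => f x₁ s)) x₂ +
    2 * k * (x₁ ^ 2 / (x₁ - x₂) * deriv (fun s => f s x₂) x₁ +
      x₂ ^ 2 / (x₂ - x₁) * deriv (fun s => f x₁ s) x₂)

/-- The normalized modified Bessel function of the first kind,
`𝓘_ν(t) = Γ(ν+1) Σ_{m≥0} (t/2)^{2m}/(m! Γ(m+ν+1))`. -/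
noncomputable def besselI (ν t : ℝ) : ℝ :=
  Real.Gamma (ν + 1) *
    ∑' m : ℕ, (t / 2) ^ (2 * m) / ((m.factorial : ℝ) * Real.Gamma (m + ν + 1))

open Real

/-- weight -/
noncomputable def wt (k u : ℝ) : ℝ := (1 - u ^ 2) ^ (k - 1)

lemma beta_aux (k : ℝ) (hk : 0 < k) :
    IntervalIntegrable (fun x : ℝ => x ^ (k-1) * (1-x)^(k-1)) MeasureTheory.volume 0 1 ∧
    ∫ x in (0:ℝ)..1, x ^ (k-1) * (1-x)^(k-1) = Gamma k ^ 2 / Gamma (2*k) := by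
  have hc := Complex.betaIntegral_convergent (u := (k:ℂ)) (v := (k:ℂ)) (by simpa) (by simpa)
  have he : Set.EqOn (fun x : ℝ => (x : ℂ) ^ ((k:ℂ) - 1) * (1 - (x : ℂ)) ^ ((k:ℂ) - 1))
      (fun x : ℝ => ((x ^ (k-1) * (1-x)^(k-1) : ℝ) : ℂ)) (Set.uIcc 0 1) := by
    intro x hx
    rw [Set.uIcc_of_le zero_le_one] at hx
    simp only
    rw [Complex.ofReal_mul, Complex.ofReal_cpow hx.1, Complex.ofReal_cpow (by linarith [hx.2])]
    push_cast; rfl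
  have hv := Complex.betaIntegral_eq_Gamma_mul_div (k:ℂ) (k:ℂ) (by simpa) (by simpa)
  rw [Complex.betaIntegral, intervalIntegral.integral_congr he, intervalIntegral.integral_ofReal,
    ← Complex.ofReal_add, Complex.Gamma_ofReal, Complex.Gamma_ofReal] at hv
  constructor
  · have h2 := hc.congr (f := _) (g := (fun x : ℝ => ((x ^ (k-1) * (1-x)^(k-1) : ℝ) : ℂ))) (by
      intro x hx; exact he (Set.uIoc_subset_uIcc hx))
    rw [intervalIntegrable_iff] at h2 ⊢
    have h3 : MeasureTheory.Integrable _ _ := h2.re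
    simp only [RCLike.re_to_complex, Complex.ofReal_re] at h3
    exact h3
  · have : (2*k) = k + k := by ring
    rw [this, sq]
    exact_mod_cast hv

lemma wt_comp (k x : ℝ) (hx : x ∈ Set.uIcc (0:ℝ) 1) :
    wt k (2 * x - 1) = 4 ^ (k-1) * (x ^ (k-1) * (1-x)^(k-1)) := by
  rw [Set.uIcc_of_le zero_le_one] at hx
  unfold wt
  rw [← Real.mul_rpow hx.1 (by linarith [hx.2]), ← Real.mul_rpow (by norm_num)
    (mul_nonneg hx.1 (by linarith [hx.2]))]
  congr 1; ring

lemma wt_integrable (k : ℝ) (hk : 0 < k) :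
    IntervalIntegrable (wt k) MeasureTheory.volume (-1) 1 := by
  have h := ((beta_aux k hk).1.const_mul (4 ^ (k-1))).congr (g := fun x => wt k (2*x-1))
    (fun x hx => (wt_comp k x (Set.uIoc_subset_uIcc hx)).symm)
  have h2 := (h.comp_mul_left (c := 1/2)).comp_add_right 1
  have e : (fun x : ℝ => wt k (2 * (1 / 2 * (x + 1)) - 1)) = wt k := by
    funext x; congr 1; ring
  rw [e] at h2
  norm_num at h2
  exact h2

lemma wt_integral (k : ℝ) (hk : 0 < k) :
    ∫ u in (-1:ℝ)..1, wt k u = 2 ^ (2*k-1) * (Gamma k ^ 2 / Gamma (2*k)) := by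
  have h := intervalIntegral.integral_comp_mul_sub (a := 0) (b := 1) (wt k) (c := 2) (by norm_num) 1
  rw [intervalIntegral.integral_congr (fun x hx => wt_comp k x hx),
    intervalIntegral.integral_const_mul, (beta_aux k hk).2, smul_eq_mul, show (2:ℝ)*0-1 = -1 by norm_num,
    show (2:ℝ)*1-1 = 1 by norm_num] at h
  have e : (2:ℝ) ^ (2*k-1) = 2 * 4 ^ (k-1) := by
    rw [show (4:ℝ) = 2 ^ (2:ℝ) by norm_num, ← Real.rpow_mul (by norm_num)]
    rw [show 2*k-1 = 1 + 2*(k-1) by ring, Real.rpow_add (by norm_num), Real.rpow_one]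
  rw [e]; linarith

lemma wt_integral' (k : ℝ) (hk : 0 < k) :
    ∫ u in (-1:ℝ)..1, wt k u = √π * Gamma k / Gamma (k + 1/2) := by
  rw [wt_integral k hk]
  have h := Real.Gamma_mul_Gamma_add_half k
  have h1 := (Gamma_pos_of_pos (show 0 < 2*k by linarith)).ne'
  have h2 := (Gamma_pos_of_pos (show 0 < k+1/2 by linarith)).ne'
  have e : (2:ℝ) ^ (2*k-1) * 2 ^ (1-2*k) = 1 := by
    rw [← Real.rpow_add (by norm_num)]; norm_num
  rw [mul_div, div_eq_div_iff h1 h2]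
  linear_combination (2 ^ (2*k-1) * Gamma k) * h + (Gamma k * Gamma (2*k) * √π) * e

lemma wt_mul_integrable (k : ℝ) (hk : 0 < k) (f : ℝ → ℝ) (hf : Continuous f) :
    IntervalIntegrable (fun u => f u * wt k u) MeasureTheory.volume (-1) 1 :=
  (wt_integrable k hk).continuousOn_mul hf.continuousOn

lemma wt_mul (k u : ℝ) (hk : 0 < k) (hu : u ∈ Set.uIcc (-1:ℝ) 1) :
    (1 - u^2)^k = (1-u^2) * wt k u := by
  rw [Set.uIcc_of_le (by norm_num)] at hu
  have : 0 ≤ 1 - u^2 := by nlinarith [hu.1, hu.2]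
  unfold wt
  rcases this.eq_or_lt with h | h
  · rw [← h, zero_mul, Real.zero_rpow hk.ne']
  · rw [Real.rpow_sub_one h.ne']; field_simp

lemma wt_ibp (k : ℝ) (hk : 0 < k) (f f' : ℝ → ℝ) (hf : ∀ u, HasDerivAt f (f' u) u)
    (hf' : Continuous f') :
    ∫ u in (-1:ℝ)..1, (f' u * (1-u^2) - 2 * k * u * f u) * wt k u = 0 := by
  have hfc : Continuous f := continuous_iff_continuousAt.2 fun u => (hf u).continuousAt
  have := intervalIntegral.integral_eq_sub_of_hasDerivAt_of_le (a := -1) (b := 1)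
    (f := fun u => f u * (1-u^2)^k) (f' := fun u => (f' u * (1-u^2) - 2 * k * u * f u) * wt k u)
    (by norm_num) ?_ ?_ ?_
  · rw [this]; norm_num [Real.zero_rpow hk.ne']
  · refine (hfc.mul (Continuous.rpow_const (by fun_prop) ?_)).continuousOn
    intro x; right; exact hk.le
  · intro u hu
    have hp : 0 < 1 - u^2 := by nlinarith [hu.1, hu.2]
    have h1 : HasDerivAt (fun u : ℝ => 1 - u^2) (-(2*u)) u := by
      simpa using (hasDerivAt_pow 2 u).const_sub 1
    have h2 := h1.rpow_const (p := k) (Or.inl hp.ne')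
    have h3 := (hf u).mul h2
    refine h3.congr_deriv ?_
    rw [wt_mul k u hk (by rw [Set.uIcc_of_le (by norm_num)]; exact ⟨hu.1.le, hu.2.le⟩)]
    unfold wt; ring
  · exact wt_mul_integrable k hk _ (by fun_prop)

open Real

/-- rising factorial -/
noncomputable def poch (x : ℝ) : ℕ → ℝ
  | 0 => 1
  | n + 1 => poch x n * (x + n)

lemma poch_zero (x : ℝ) : poch x 0 = 1 := rfl
lemma poch_succ (x : ℝ) (n : ℕ) : poch x (n+1) = poch x n * (x + n) := rfl

lemma poch_pos {x : ℝ} (hx : 0 < x) (n : ℕ) : 0 < poch x n := by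
  induction n with
  | zero => simp [poch_zero]
  | succ n ih => rw [poch_succ]; positivity

lemma poch_succ_left (x : ℝ) (n : ℕ) : poch x (n+1) = x * poch (x+1) n := by
  induction n with
  | zero => simp [poch]
  | succ n ih => rw [poch_succ, ih, poch_succ]; push_cast; ring

lemma poch_add (x : ℝ) (m n : ℕ) : poch x (m+n) = poch x m * poch (x+m) n := by
  induction n with
  | zero => simp [poch]
  | succ n ih => rw [← add_assoc, poch_succ, ih, poch_succ]; push_cast; ring

lemma Gamma_add_poch {x : ℝ} (hx : 0 < x) (n : ℕ) : Gamma (x + n) = poch x n * Gamma x := by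
  induction n with
  | zero => simp [poch]
  | succ n ih =>
    have : x + n ≠ 0 := by positivity
    rw [poch_succ, Nat.cast_succ, ← add_assoc, Gamma_add_one this, ih]; ring

lemma vandermonde_poch (l : ℕ) : ∀ a b : ℝ, 0 < a → 0 < b →
    ∑ j ∈ Finset.range (l+1), (l.choose j : ℝ) / (poch a j * poch b (l - j)) =
      poch (a + b + l - 1) l / (poch a l * poch b l) := by
  induction l with
  | zero => intro a b _ _; simp [poch]
  | succ l ih =>
    intro a b ha hb
    have h1 := ih (a+1) b (by linarith) hb
    have h2 := ih a (b+1) ha (by linarith)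
    have key : ∑ j ∈ Finset.range (l+1+1), ((l+1).choose j : ℝ) / (poch a j * poch b (l + 1 - j)) =
      (1/a) * ∑ j ∈ Finset.range (l+1), (l.choose j : ℝ) / (poch (a+1) j * poch b (l - j)) +
      (1/b) * ∑ j ∈ Finset.range (l+1), (l.choose j : ℝ) / (poch a j * poch (b+1) (l - j)) := by
      rw [Finset.sum_range_succ']
      simp only [Nat.choose_succ_succ, Nat.cast_add, add_div, Finset.sum_add_distrib]
      rw [add_assoc]
      congr 1
      · rw [Finset.mul_sum]
        refine Finset.sum_congr rfl fun j hj => ?_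
        rw [poch_succ_left, show l + 1 - (j+1) = l - j by omega]
        have := poch_pos (show 0 < a + 1 by linarith) j
        have := poch_pos hb (l-j)
        field_simp
      · rw [Finset.sum_range_succ, Finset.mul_sum, Finset.sum_range_succ']
        simp only [Nat.choose_succ_self, Nat.cast_zero, zero_div, add_zero]
        congr 1
        · refine Finset.sum_congr rfl fun j hj => ?_
          have hj' := Finset.mem_range.1 hj
          rw [show l + 1 - (j+1) = (l - (j+1)) + 1 by omega, poch_succ_left b]
          have := poch_pos (show 0 < b + 1 by linarith) (l - (j+1))
          have := poch_pos ha (j+1)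
          field_simp
        · simp only [Nat.sub_zero, poch_zero, Nat.choose_zero_right, Nat.cast_one]
          rw [poch_succ_left b]
          have := poch_pos (show 0 < b + 1 by linarith) l
          field_simp
    rw [key, h1, h2]
    have e1 : a * poch (a+1) l = poch a l * (a + l) := by rw [← poch_succ_left, poch_succ]
    have e2 : b * poch (b+1) l = poch b l * (b + l) := by rw [← poch_succ_left, poch_succ]
    have p1 := poch_pos ha l
    have p2 := poch_pos hb l
    rw [show a + 1 + b + l - 1 = a + b + l by ring, show a + (b + 1) + l - 1 = a + b + l by ring]
    rw [show a + b + ((l+1 : ℕ):ℝ) - 1 = a + b + l by push_cast; ring]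
    rw [poch_succ, poch_succ, poch_succ]
    rw [one_div_mul_eq_div, one_div_mul_eq_div, div_div, div_div]
    rw [show poch (a+1) l * poch b l * a = poch a l * (a + l) * poch b l by rw [← e1]; ring]
    rw [show poch a l * poch (b+1) l * b = poch a l * (poch b l * (b + l)) by rw [← e2]; ring]
    have : 0 < a + l := by positivity
    have : 0 < b + l := by positivity
    field_simp
    ring

/-- moments -/
noncomputable def Mo (k c d : ℝ) (i j : ℕ) : ℝ :=
  ∫ u in (-1:ℝ)..1, (((c + d) / 2 + u * (c - d) / 2) ^ i * ((c + d) / 2 - u * (c - d) / 2) ^ j) * wt k u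

lemma Mo_rec (k c d : ℝ) (hk : 0 < k) (i j : ℕ) :
    (i + k) * Mo k c d i (j+1) - (j + k) * Mo k c d (i+1) j =
      c * d * (i * Mo k c d (i-1) j - j * Mo k c d i (j-1)) := by
  have h1 : ∀ u : ℝ, HasDerivAt (fun u => (c + d) / 2 + u * (c - d) / 2) ((c-d)/2) u := by
    intro u
    have := (((hasDerivAt_id u).mul_const (c-d)).div_const 2).const_add ((c+d)/2)
    simpa using this
  have h2 : ∀ u : ℝ, HasDerivAt (fun u => (c + d) / 2 - u * (c - d) / 2) (-((c-d)/2)) u := by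
    intro u
    have := (((hasDerivAt_id u).mul_const (c-d)).div_const 2).const_sub ((c+d)/2)
    simpa using this
  have h := wt_ibp k hk (fun u => ((c-d)/2) * (((c + d) / 2 + u * (c - d) / 2)^i *
      ((c + d) / 2 - u * (c - d) / 2)^j)) _
    (fun u => (((h1 u).pow i).mul ((h2 u).pow j)).const_mul ((c-d)/2)) (by fun_prop)
  have hi : ∀ i j : ℕ, IntervalIntegrable (fun u => (((c + d) / 2 + u * (c - d) / 2) ^ i *
      ((c + d) / 2 - u * (c - d) / 2) ^ j) * wt k u) MeasureTheory.volume (-1) 1 :=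
    fun i j => wt_mul_integrable k hk _ (by fun_prop)
  have e : (i + k) * Mo k c d i (j+1) - (j + k) * Mo k c d (i+1) j -
      c * d * (i * Mo k c d (i-1) j - j * Mo k c d i (j-1)) = 0 := by
    rw [← h]
    unfold Mo
    rw [← intervalIntegral.integral_const_mul, ← intervalIntegral.integral_const_mul,
      ← intervalIntegral.integral_const_mul (i:ℝ), ← intervalIntegral.integral_const_mul (j:ℝ),
      ← intervalIntegral.integral_sub ((hi _ _).const_mul _) ((hi _ _).const_mul _),
      ← intervalIntegral.integral_sub ((hi _ _).const_mul _) ((hi _ _).const_mul _),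
      ← intervalIntegral.integral_const_mul,
      ← intervalIntegral.integral_sub]
    · refine intervalIntegral.integral_congr fun u _ => ?_
      simp only [Pi.pow_apply]
      rcases i with _ | i <;> rcases j with _ | j <;> push_cast <;> simp <;> ring
    · exact ((hi _ _).const_mul _).sub ((hi _ _).const_mul _)
    · exact (((hi _ _).const_mul _).sub ((hi _ _).const_mul _)).const_mul _
  linarith

lemma Mo_add (k c d : ℝ) (hk : 0 < k) (i j : ℕ) :
    Mo k c d (i+1) j + Mo k c d i (j+1) = (c + d) * Mo k c d i j := by
  have hi : ∀ i j : ℕ, IntervalIntegrable (fun u => (((c + d) / 2 + u * (c - d) / 2) ^ i *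
      ((c + d) / 2 - u * (c - d) / 2) ^ j) * wt k u) MeasureTheory.volume (-1) 1 :=
    fun i j => wt_mul_integrable k hk _ (by fun_prop)
  unfold Mo
  rw [← intervalIntegral.integral_const_mul, ← intervalIntegral.integral_add (hi _ _) (hi _ _)]
  refine intervalIntegral.integral_congr fun u _ => ?_
  ring

lemma Mo_binom (k a b c d : ℝ) (hk : 0 < k) (m : ℕ) :
    ∫ u in (-1:ℝ)..1, (a * ((c + d) / 2 + u * (c - d) / 2) + b * ((c + d) / 2 - u * (c - d) / 2)) ^ m
      * wt k u = ∑ j ∈ Finset.range (m+1), (m.choose j : ℝ) * (a^j * b^(m-j)) * Mo k c d j (m-j) := by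
  have hi : ∀ i j : ℕ, IntervalIntegrable (fun u => (((c + d) / 2 + u * (c - d) / 2) ^ i *
      ((c + d) / 2 - u * (c - d) / 2) ^ j) * wt k u) MeasureTheory.volume (-1) 1 :=
    fun i j => wt_mul_integrable k hk _ (by fun_prop)
  unfold Mo
  simp_rw [← intervalIntegral.integral_const_mul]
  rw [← intervalIntegral.integral_finsetSum (fun j _ => (hi _ _).const_mul _)]
  refine intervalIntegral.integral_congr fun u _ => ?_
  rw [add_pow, Finset.sum_mul]
  refine Finset.sum_congr rfl fun j _ => ?_
  rw [mul_pow, mul_pow]; ring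

lemma Mo_zero_pos (k c d : ℝ) (hk : 0 < k) : 0 < Mo k c d 0 0 := by
  unfold Mo
  simp only [pow_zero, mul_one, one_mul]
  rw [wt_integral k hk]
  have := Gamma_pos_of_pos hk
  have := Gamma_pos_of_pos (show 0 < 2 * k by linarith)
  positivity

lemma Mo_one_zero (k : ℝ) (hk : 0 < k) (j : ℕ) : ∀ i : ℕ, 
    Mo k 1 0 i j = poch k i * poch k j / poch (2*k) (i+j) * Mo k 1 0 0 0 := by
  have base : ∀ i : ℕ, Mo k 1 0 i 0 = poch k i / poch (2*k) i * Mo k 1 0 0 0 := by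
    intro i
    induction i with
    | zero => simp [poch]
    | succ i ih =>
      have h1 := Mo_rec k 1 0 hk i 0
      have h2 := Mo_add k 1 0 hk i 0
      rw [ih] at h2
      have := poch_pos (show 0 < 2 * k by linarith) i
      rw [poch_succ, poch_succ]
      have : 0 < 2 * k + i := by positivity
      simp only [Nat.cast_zero, mul_zero, zero_mul] at h1
      have h3 : (2*k+i) * Mo k 1 0 (i+1) 0 = (i + k) * (poch k i / poch (2 * k) i * Mo k 1 0 0 0) := by
        linear_combination -h1 + (i+k) * h2
      rw [div_mul_eq_mul_div, eq_div_iff (by positivity)]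
      rw [div_mul_eq_mul_div, mul_div, eq_div_iff (by positivity)] at h3
      linear_combination h3
  induction j with
  | zero => intro i; rw [base]; simp [poch]
  | succ j ih =>
    intro i
    have h1 := Mo_rec k 1 0 hk i j
    rw [ih (i+1)] at h1
    have : 0 < i + k := by positivity
    have h3 : Mo k 1 0 i (j+1) = (j+k) * (poch k (i + 1) * poch k j / poch (2 * k) (i + 1 + j) * Mo k 1 0 0 0) / (i+k) := by
      rw [eq_div_iff this.ne']; linarith
    rw [h3, poch_succ, poch_succ, show i + 1 + j = i + (j+1) by ring]
    have := poch_pos (show 0 < 2 * k by linarith) (i+(j+1))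
    field_simp
    ring

open Real

/-- g -/
noncomputable def gz (k : ℝ) (n : ℤ) : ℝ :=
  if n < 0 then 0 else poch k n.toNat / (n.toNat.factorial : ℝ)

lemma gz_neg (k : ℝ) {n : ℤ} (h : n < 0) : gz k n = 0 := by simp [gz, h]

lemma gz_nat (k : ℝ) (n : ℕ) : gz k n = poch k n / (n.factorial : ℝ) := by simp [gz]

lemma gz_succ (k : ℝ) (n : ℤ) : ((n:ℝ) + 1) * gz k (n+1) = (n + k) * gz k n := by
  rcases lt_or_ge n (-1) with h | h
  · rw [gz_neg k (by omega), gz_neg k (by omega)]; simp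
  · rcases h.eq_or_lt with h | h
    · rw [← h]; simp [gz]
    · obtain ⟨m, rfl⟩ := Int.eq_ofNat_of_zero_le (show 0 ≤ n by omega)
      rw [show ((m:ℤ) + 1) = ((m+1 : ℕ) : ℤ) by push_cast; rfl, gz_nat, gz_nat, poch_succ,
        Nat.factorial_succ]
      have := Nat.factorial_pos m
      push_cast
      field_simp
      ring

/-- symmetric polynomial, coefficients g -/
noncomputable def qz (k a b : ℝ) (m : ℕ) : ℝ :=
  ∑ j ∈ Finset.range (m+1), a^j * b^(m-j) * (gz k j * gz k ((m - j : ℕ) : ℤ))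

lemma JackP_eq (k a b : ℝ) (hk : 0 < k) (m : ℕ) :
    JackP k m 0 a b = (m.factorial : ℝ) / poch k m * qz k a b m := by
  unfold JackP qz
  have h := Mo_binom k a b 1 0 hk m
  have e : ∫ u in (-1 : ℝ)..1, ((a + b) / 2 + u * (a - b) / 2) ^ m * (1 - u ^ 2) ^ (k - 1) =
      ∫ u in (-1:ℝ)..1, (a * ((1 + 0) / 2 + u * (1 - 0) / 2) + b * ((1 + 0) / 2 - u * (1 - 0) / 2)) ^ m
      * wt k u := by
    refine intervalIntegral.integral_congr fun u _ => ?_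
    unfold wt; ring
  rw [e, h, pow_zero, one_mul, Finset.mul_sum, Finset.mul_sum]
  refine Finset.sum_congr rfl fun j hj => ?_
  have hj' := Nat.lt_succ_iff.1 (Finset.mem_range.1 hj)
  rw [Mo_one_zero k hk, gz_nat, gz_nat, Nat.cast_choose ℝ hj']
  have hW : Mo k 1 0 0 0 = 2 ^ (2*k-1) * (Gamma k ^ 2 / Gamma (2*k)) := by
    rw [← wt_integral k hk]; simp [Mo]
  rw [hW, Nat.add_sub_cancel' hj', add_comm (m:ℝ) (2*k), add_comm (m:ℝ) k, Gamma_add_poch hk,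
    Gamma_add_poch (show 0 < 2*k by linarith)]
  have := Gamma_pos_of_pos hk
  have := Gamma_pos_of_pos (show 0 < 2 * k by linarith)
  have := poch_pos hk m
  have := poch_pos (show 0 < 2 * k by linarith) m
  have : (0:ℝ) < 2 ^ (2*k-1) := by positivity
  have := Nat.factorial_pos m
  have := Nat.factorial_pos j
  have := Nat.factorial_pos (m-j)
  field_simp

lemma Jack_ratio (k c d : ℝ) (hk : 0 < k) (m : ℕ) :
    JackP k m 0 c d / JackP k m 0 1 1 = Mo k c d m 0 / Mo k c d 0 0 := by
  unfold JackP Mo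
  have e1 : ∫ u in (-1 : ℝ)..1, (((1:ℝ) + 1) / 2 + u * (1 - 1) / 2) ^ m * (1 - u ^ 2) ^ (k - 1) =
    ∫ u in (-1:ℝ)..1, (((c + d) / 2 + u * (c - d) / 2) ^ 0 * ((c + d) / 2 - u * (c - d) / 2) ^ 0) * wt k u := by
    simp [wt]
  rw [e1]
  simp only [pow_zero, mul_one, one_mul]
  have := Gamma_pos_of_pos hk
  have := Gamma_pos_of_pos (show 0 < m + 2 * k by positivity)
  have := Gamma_pos_of_pos (show 0 < m + k by positivity)
  rw [mul_div_mul_left _ _ (by positivity)]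
  rfl

/-- expansion array term -/
noncomputable def Ntt (k e : ℝ) (p : ℕ → ℝ) (i : ℕ) (α β : ℤ) : ℝ :=
  e ^ i / (i.factorial : ℝ) * (p (α + β - 2 * i).toNat /
    (poch k (α + β - 2 * i).toNat * poch (k + ((α + β - 2 * i : ℤ) : ℝ) + 1) i)) *
    (gz k (α - i) * gz k (β - i))

/-- expansion array -/
noncomputable def Nt (k e : ℝ) (p : ℕ → ℝ) (K : ℕ) (α β : ℤ) : ℝ :=
  ∑ i ∈ Finset.range K, Ntt k e p i α β

lemma Nt_rec (k e : ℝ) (hk : 0 < k) (p : ℕ → ℝ) (K : ℕ) (α β : ℤ) :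
    (α + k) * (β + 1) * Nt k e p (K+1) α (β+1) - (β + k) * (α + 1) * Nt k e p (K+1) (α+1) β =
      e * (Nt k e p K (α - 1) β - Nt k e p K α (β - 1)) := by
  unfold Nt
  rw [Finset.sum_range_succ', Finset.sum_range_succ', mul_add (((α:ℝ) + k) * (β + 1)),
    mul_add (((β:ℝ) + k) * (α + 1)), Finset.mul_sum,
    Finset.mul_sum, mul_sub, Finset.mul_sum, Finset.mul_sum, add_sub_add_comm,
    ← Finset.sum_sub_distrib, ← Finset.sum_sub_distrib]
  have z : (α + k) * (β + 1) * Ntt k e p 0 α (β+1) - (β + k) * (α + 1) * Ntt k e p 0 (α+1) β = 0 := by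
    unfold Ntt
    have h1 := gz_succ k α
    have h2 := gz_succ k β
    rw [show α + (β + 1) - 2 * ((0:ℕ):ℤ) = α + β + 1 by push_cast; ring,
      show α + 1 + β - 2 * ((0:ℕ):ℤ) = α + β + 1 by push_cast; ring]
    simp only [Nat.cast_zero, sub_zero]
    linear_combination (e ^ 0 / (Nat.factorial 0 : ℝ) * (p (α + β + 1).toNat /
      (poch k (α + β + 1).toNat * poch (k + ((α + β + 1 : ℤ) : ℝ) + 1) 0))) *
      ((α + k) * gz k α * h2 - (β + k) * gz k β * h1)
  rw [z, add_zero]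
  refine Finset.sum_congr rfl fun i _ => ?_
  unfold Ntt
  obtain ⟨A, rfl⟩ : ∃ A : ℤ, α = A + i + 1 := ⟨α - i - 1, by ring⟩
  obtain ⟨B, rfl⟩ : ∃ B : ℤ, β = B + i + 1 := ⟨β - i - 1, by ring⟩
  have h1 := gz_succ k A
  have h2 := gz_succ k B
  rw [show A + i + 1 + (B + i + 1 + 1) - 2 * ((i + 1 : ℕ) : ℤ) = A + B + 1 by push_cast; ring,
    show A + i + 1 + 1 + (B + i + 1) - 2 * ((i + 1 : ℕ) : ℤ) = A + B + 1 by push_cast; ring,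
    show A + i + 1 - 1 + (B + i + 1) - 2 * (i : ℤ) = A + B + 1 by ring,
    show A + i + 1 + (B + i + 1 - 1) - 2 * (i : ℤ) = A + B + 1 by ring,
    show A + i + 1 - ((i + 1 : ℕ) : ℤ) = A by push_cast; ring,
    show B + i + 1 - ((i + 1 : ℕ) : ℤ) = B by push_cast; ring,
    show B + i + 1 + 1 - ((i + 1 : ℕ) : ℤ) = B + 1 by push_cast; ring,
    show A + i + 1 + 1 - ((i + 1 : ℕ) : ℤ) = A + 1 by push_cast; ring,
    show A + i + 1 - 1 - (i : ℤ) = A by ring,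
    show B + i + 1 - 1 - (i : ℤ) = B by ring,
    show A + i + 1 - (i : ℤ) = A + 1 by ring,
    show B + i + 1 - (i : ℤ) = B + 1 by ring]
  push_cast
  have main : ((A:ℝ) + i + 1 + k) * (B + i + 1 + 1) * (gz k A * gz k (B+1)) -
     (B + i + 1 + k) * (A + i + 1 + 1) * (gz k (A+1) * gz k B) =
     (i + 1) * (A + B + 1 + (i + 1) + k) * (gz k A * gz k (B+1) - gz k (A+1) * gz k B) := by
    linear_combination ((A + k) * gz k A) * h2 - ((B+k) * gz k B) * h1
  rcases lt_or_ge (A + B + 1) 0 with hm | hm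
  · have z1 : gz k A * gz k (B+1) = 0 := by
      rcases lt_or_ge A 0 with h | h
      · rw [gz_neg k h, zero_mul]
      · rw [gz_neg k (show B + 1 < 0 by omega), mul_zero]
    have z2 : gz k (A+1) * gz k B = 0 := by
      rcases lt_or_ge B 0 with h | h
      · rw [gz_neg k h, mul_zero]
      · rw [gz_neg k (show A + 1 < 0 by omega), zero_mul]
    rw [z1, z2]; ring
  · have hm' : (0:ℝ) ≤ (A:ℝ) + B + 1 := by exact_mod_cast hm
    have p1 := poch_pos hk (A + B + 1).toNat
    have p2 := poch_pos (show 0 < k + ((A:ℝ) + B + 1) + 1 by linarith) i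
    rw [poch_succ, Nat.factorial_succ, pow_succ]
    have := Nat.factorial_pos i
    have : 0 < k + ((A:ℝ) + B + 1) + 1 + i := by positivity
    push_cast
    generalize poch (k + ((A:ℝ) + B + 1) + 1) i = P2 at *
    generalize poch k (A + B + 1).toNat = P1 at *
    generalize p (A + B + 1).toNat = pp at *
    field_simp
    linear_combination (e * e^i * pp) * main

lemma Nt_neg (k e : ℝ) (p : ℕ → ℝ) (K : ℕ) (β : ℤ) : Nt k e p K (-1) β = 0 := by
  unfold Nt Ntt
  refine Finset.sum_eq_zero fun i _ => ?_
  rw [gz_neg k (show -1 - (i:ℤ) < 0 by omega)]; ring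

lemma Nt_neg' (k e : ℝ) (p : ℕ → ℝ) (K : ℕ) (α : ℤ) : Nt k e p K α (-1) = 0 := by
  unfold Nt Ntt
  refine Finset.sum_eq_zero fun i _ => ?_
  rw [gz_neg k (show -1 - (i:ℤ) < 0 by omega)]; ring

lemma Nt_base (k e : ℝ) (hk : 0 < k) (p : ℕ → ℝ) (K : ℕ) (α : ℕ) :
    Nt k e p (K+1) α 0 = p α / (α.factorial : ℝ) := by
  unfold Nt
  rw [Finset.sum_range_succ', Finset.sum_eq_zero]
  · unfold Ntt
    have := poch_pos hk α
    simp [gz_nat, show gz k 0 = 1 by simp [gz, poch], poch]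
    field_simp
  · intro i _
    unfold Ntt
    rw [gz_neg k (show 0 - ((i+1:ℕ):ℤ) < 0 by push_cast; omega)]; ring

lemma Mo_eq_Nt (k c d : ℝ) (hk : 0 < k) (β : ℕ) : ∀ (α K : ℕ), β < K →
    Mo k c d α β / Mo k c d 0 0 = (α.factorial : ℝ) * (β.factorial : ℝ) *
      Nt k (c*d) (fun m => Mo k c d m 0 / Mo k c d 0 0) K α β := by
  induction β using Nat.strong_induction_on with
  | _ β ih =>
    intro α K hK
    obtain ⟨K, rfl⟩ : ∃ K', K = K' + 1 := ⟨K - 1, by omega⟩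
    rcases β with _ | β
    · have := Nat.factorial_pos α
      rw [Nat.cast_zero, Nt_base k _ hk]
      field_simp
      simp
    · have h1 := Mo_rec k c d hk α β
      have h2 := Nt_rec k (c*d) hk (fun m => Mo k c d m 0 / Mo k c d 0 0) K α β
      have i1 := ih β (by omega) (α+1) (K+1) (by omega)
      have hα : (α:ℝ) * Mo k c d (α-1) β / Mo k c d 0 0 = (α.factorial : ℝ) * (β.factorial : ℝ) *
          Nt k (c*d) (fun m => Mo k c d m 0 / Mo k c d 0 0) K (α - 1) β := by
        rcases α with _ | α
        · simp [Nt_neg]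
        · have := ih β (by omega) α K (by omega)
          rw [Nat.add_sub_cancel, mul_div_assoc, this, Nat.factorial_succ]
          push_cast
          rw [add_sub_cancel_right]; ring
      have hβ : (β:ℝ) * Mo k c d α (β-1) / Mo k c d 0 0 = (α.factorial : ℝ) * (β.factorial : ℝ) *
          Nt k (c*d) (fun m => Mo k c d m 0 / Mo k c d 0 0) K α (β - 1) := by
        rcases β with _ | β
        · simp [Nt_neg']
        · have := ih β (by omega) α K (by omega)
          rw [Nat.add_sub_cancel, mul_div_assoc, this, Nat.factorial_succ]
          push_cast
          rw [add_sub_cancel_right]; ring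
      have hpos : 0 < (α:ℝ) + k := by positivity
      apply mul_left_cancel₀ hpos.ne'
      rw [Nat.factorial_succ] at i1 ⊢
      push_cast at *
      generalize Nt k (c*d) (fun m => Mo k c d m 0 / Mo k c d 0 0) = NN at *
      generalize hW : Mo k c d 0 0 = W at *
      have hW' : W ≠ 0 := by rw [← hW]; exact (Mo_zero_pos k c d hk).ne'
      have h1' : (α + k) * (Mo k c d α (β+1) / W) - (β + k) * (Mo k c d (α+1) β / W) =
        c * d * (α * Mo k c d (α-1) β / W - β * Mo k c d α (β-1) / W) := by
        field_simp; linear_combination h1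
      linear_combination h1' + (β + k) * i1 + c * d * (hα - hβ) - (α.factorial : ℝ) * (β.factorial : ℝ) * h2

open Real

lemma sum_shift (k a b : ℝ) (i : ℕ) : ∀ m : ℕ,
    ∑ j ∈ Finset.range (m + 2*i + 1), a^j * b^(m + 2*i - j) *
      (gz k ((j:ℤ) - i) * gz k (((m + 2*i - j : ℕ) : ℤ) - i)) = (a*b)^i * qz k a b m := by
  induction i with
  | zero => intro m; simp [qz]
  | succ i ih =>
    intro m
    rw [show m + 2*(i+1) + 1 = (m + 2 * i + 1) + 1 + 1 by ring, Finset.sum_range_succ,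
      Finset.sum_range_succ']
    rw [gz_neg k (show ((0:ℕ):ℤ) - ((i+1:ℕ):ℤ) < 0 by push_cast; omega)]
    rw [gz_neg k (show (((m + 2 * (i+1) - (m + 2 * i + 1 + 1) : ℕ)):ℤ) - ((i+1:ℕ):ℤ) < 0 by omega)]
    rw [pow_succ (a*b), mul_right_comm ((a*b)^i), ← ih m, Finset.sum_mul]
    simp only [zero_mul, mul_zero, add_zero]
    refine Finset.sum_congr rfl fun j hj => ?_
    have hj' := Finset.mem_range.1 hj
    rw [show m + 2 * (i + 1) - (j + 1) = (m + 2 * i - j) + 1 by omega]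
    rw [show ((j+1:ℕ):ℤ) - ((i+1:ℕ):ℤ) = (j:ℤ) - i by push_cast; ring]
    rw [show ((m + 2 * i - j + 1 : ℕ):ℤ) - ((i+1:ℕ):ℤ) = ((m + 2*i - j : ℕ) : ℤ) - i by push_cast; ring]
    ring

/-- D -/
noncomputable def Dz (k a b c d : ℝ) (m : ℤ) : ℝ :=
  if m < 0 then 0 else JackP k m.toNat 0 a b * (Mo k c d m.toNat 0 / Mo k c d 0 0) /
    (m.toNat.factorial : ℝ)

/-- Q -/
noncomputable def Qi (k a b c d : ℝ) (p : ℕ) : ℝ :=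
  ∫ u in (-1:ℝ)..1, (a * ((c + d) / 2 + u * (c - d) / 2) + b * ((c + d) / 2 - u * (c - d) / 2)) ^ p
      * wt k u

lemma Q_expand (k a b c d : ℝ) (hk : 0 < k) (p K : ℕ) (hK : p < K) :
    Qi k a b c d p / Mo k c d 0 0 / (p.factorial : ℝ) =
      ∑ i ∈ Finset.range K, (a*b*c*d)^i / ((i.factorial : ℝ) *
        poch (k + (((p:ℤ) - 2*i : ℤ) : ℝ) + 1) i) * Dz k a b c d ((p:ℤ) - 2 * i) := by
  have h1 : Qi k a b c d p / Mo k c d 0 0 / (p.factorial : ℝ) =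
      ∑ j ∈ Finset.range (p+1), a^j * b^(p-j) *
        Nt k (c*d) (fun m => Mo k c d m 0 / Mo k c d 0 0) K (j:ℤ) ((p - j : ℕ) : ℤ) := by
    unfold Qi
    rw [Mo_binom k a b c d hk, Finset.sum_div, Finset.sum_div]
    refine Finset.sum_congr rfl fun j hj => ?_
    have hj' := Nat.lt_succ_iff.1 (Finset.mem_range.1 hj)
    have := Mo_eq_Nt k c d hk (p-j) j K (by omega)
    rw [mul_div_assoc, this, Nat.cast_choose ℝ hj']
    have := Nat.factorial_pos p
    have := Nat.factorial_pos j
    have := Nat.factorial_pos (p-j)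
    field_simp
  rw [h1]
  unfold Nt
  simp_rw [Finset.mul_sum]
  rw [Finset.sum_comm]
  refine Finset.sum_congr rfl fun i _ => ?_
  have h2 : ∀ j ∈ Finset.range (p+1), a^j * b^(p-j) *
      Ntt k (c*d) (fun m => Mo k c d m 0 / Mo k c d 0 0) i (j:ℤ) ((p - j : ℕ) : ℤ) =
      ((c*d) ^ i / (i.factorial : ℝ) * (Mo k c d ((p:ℤ) - 2 * i).toNat 0 / Mo k c d 0 0 /
    (poch k ((p:ℤ) - 2 * i).toNat * poch (k + (((p:ℤ) - 2 * i : ℤ) : ℝ) + 1) i))) *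
      (a^j * b^(p-j) * (gz k ((j:ℤ) - i) * gz k (((p - j : ℕ) : ℤ) - i))) := by
    intro j hj
    have hj' := Nat.lt_succ_iff.1 (Finset.mem_range.1 hj)
    unfold Ntt
    rw [show (j:ℤ) + ((p - j : ℕ) : ℤ) - 2 * i = (p:ℤ) - 2 * i by omega]
    ring
  rw [Finset.sum_congr rfl h2, ← Finset.mul_sum]
  rcases lt_or_ge p (2*i) with h | h
  · rw [Finset.sum_eq_zero, Dz, if_pos (by omega)]
    · simp
    · intro j hj
      have hj' := Nat.lt_succ_iff.1 (Finset.mem_range.1 hj)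
      rcases lt_or_ge j i with h3 | h3
      · rw [gz_neg k (show (j:ℤ) - i < 0 by omega)]; ring
      · rw [gz_neg k (show ((p - j : ℕ):ℤ) - i < 0 by omega)]; ring
  · obtain ⟨m, rfl⟩ : ∃ m, p = m + 2 * i := ⟨p - 2*i, by omega⟩
    rw [sum_shift, Dz, if_neg (by omega)]
    rw [show ((m + 2 * i : ℕ) : ℤ) - 2 * i = (m:ℤ) by push_cast; ring]
    rw [Int.toNat_natCast, JackP_eq k a b hk, mul_assoc (a*b) c d, mul_pow (a*b)]
    have := poch_pos hk m
    have := poch_pos (show 0 < k + ((m:ℤ):ℝ) + 1 by push_cast; positivity) i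
    have := Nat.factorial_pos m
    have := Nat.factorial_pos i
    have := Mo_zero_pos k c d hk
    field_simp

/-- moments -/
noncomputable def Mv (κ : ℝ) (n : ℕ) : ℝ := ∫ v in (-1:ℝ)..1, v ^ n * wt κ v

lemma Mv_rec (κ : ℝ) (hκ : 0 < κ) (n : ℕ) : (n + 1 + 2 * κ) * Mv κ (n+2) = (n+1) * Mv κ n := by
  have h := wt_ibp κ hκ (fun v => v^(n+1)) _ (fun v => hasDerivAt_pow (n+1) v) (by fun_prop)
  have hi : ∀ n : ℕ, IntervalIntegrable (fun v => v ^ n * wt κ v) MeasureTheory.volume (-1) 1 :=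
    fun n => wt_mul_integrable κ hκ _ (by fun_prop)
  have e : (n+1) * Mv κ n - (n + 1 + 2 * κ) * Mv κ (n+2) = 0 := by
    rw [← h]; unfold Mv
    rw [← intervalIntegral.integral_const_mul, ← intervalIntegral.integral_const_mul,
      ← intervalIntegral.integral_sub ((hi _).const_mul _) ((hi _).const_mul _)]
    refine intervalIntegral.integral_congr fun u _ => ?_
    simp only [Nat.add_sub_cancel]; push_cast; ring
  linarith

lemma Mv_odd (κ : ℝ) (hκ : 0 < κ) (j : ℕ) : Mv κ (2*j+1) = 0 := by
  induction j with
  | zero =>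
    have h := wt_ibp κ hκ (fun _ => 1) _ (fun v => hasDerivAt_const v 1) (by fun_prop)
    have e : (-2 * κ) * Mv κ 1 = 0 := by
      rw [← h]; unfold Mv
      rw [← intervalIntegral.integral_const_mul]
      refine intervalIntegral.integral_congr fun u _ => ?_
      ring
    rcases mul_eq_zero.1 e with h | h
    · linarith
    · simpa using h
  | succ j ih =>
    have h := Mv_rec κ hκ (2*j+1)
    rw [ih, mul_zero] at h
    rcases mul_eq_zero.1 h with h | h
    · exfalso; have : 0 < ((2*j+1:ℕ):ℝ) + 1 + 2 * κ := by positivity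
      linarith
    · exact h

lemma Mv_even (κ : ℝ) (hκ : 0 < κ) (j : ℕ) :
    4 ^ j * Mv κ (2*j) / ((2*j).factorial : ℝ) = Mv κ 0 / ((j.factorial : ℝ) * poch (κ + 1/2) j) := by
  induction j with
  | zero => simp [poch]
  | succ j ih =>
    have h := Mv_rec κ hκ (2*j)
    have := poch_pos (show 0 < κ + 1/2 by linarith) j
    have h' : Mv κ (2*j+2) = (2*j+1) * Mv κ (2*j) / (2*j+1+2*κ) := by
      rw [eq_div_iff (by positivity)]; push_cast at h; linarith
    rw [show 2*(j+1) = 2*j+1+1 by ring, h', Nat.factorial_succ, Nat.factorial_succ, Nat.factorial_succ,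
      poch_succ]
    generalize poch (κ + 1/2) j = P at *
    have hf1 := Nat.factorial_pos j
    have hf2 := Nat.factorial_pos (2*j)
    have e : Mv κ 0 = 4 ^ j * Mv κ (2*j) / ((2*j).factorial : ℝ) * ((j.factorial : ℝ) * P) := by
      rw [ih]; field_simp
    rw [e]
    push_cast
    have : 0 < 2 * (j:ℝ) + 1 + 2 * κ := by positivity
    have : 0 < κ + 1/2 + (j:ℝ) := by positivity
    have : κ + 1/2 + (j:ℝ) = (2 * (j:ℝ) + 1 + 2 * κ)/2 := by ring
    rw [this]
    field_simp
    ring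

lemma sum_even (f : ℕ → ℝ) (hf : ∀ j, f (2*j+1) = 0) (K : ℕ) :
    ∑ n ∈ Finset.range (2*K), f n = ∑ j ∈ Finset.range K, f (2*j) := by
  induction K with
  | zero => simp
  | succ K ih =>
    rw [show 2*(K+1) = 2*K+1+1 by ring, Finset.sum_range_succ, Finset.sum_range_succ, ih,
      Finset.sum_range_succ, hf, add_zero]

lemma inner_int (κ₁ R e w : ℝ) (h₁ : 0 < κ₁) (N : ℕ) :
    ∫ v in (-1:ℝ)..1, (e + v * R)^N * w * wt κ₁ v =
      ∑ j ∈ Finset.range (N+1), ((N.choose (2*j) : ℝ) * (R^2)^j * Mv κ₁ (2*j)) *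
        (e^(N - 2*j) * w) := by
  have hi : ∀ n : ℕ, IntervalIntegrable (fun v => v ^ n * wt κ₁ v) MeasureTheory.volume (-1) 1 :=
    fun n => wt_mul_integrable κ₁ h₁ _ (by fun_prop)
  have e1 : ∫ v in (-1:ℝ)..1, (e + v * R)^N * w * wt κ₁ v =
    ∑ n ∈ Finset.range (N+1), (N.choose n : ℝ) * (R^n) * Mv κ₁ n * (e^(N - n) * w) := by
    unfold Mv
    simp_rw [← intervalIntegral.integral_const_mul, ← intervalIntegral.integral_mul_const]
    rw [← intervalIntegral.integral_finsetSum
      (fun n _ => ((hi n).const_mul _).mul_const _)]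
    refine intervalIntegral.integral_congr fun v _ => ?_
    rw [add_comm e, add_pow, Finset.sum_mul, Finset.sum_mul]
    refine Finset.sum_congr rfl fun j _ => ?_
    rw [mul_pow]; ring
  rw [e1]
  have e2 := sum_even (fun n => (N.choose n : ℝ) * (R^n) * Mv κ₁ n * (e^(N - n) * w))
    (fun j => by simp [Mv_odd κ₁ h₁]) (N+1)
  simp only [pow_mul] at e2
  rw [← e2]
  refine Finset.sum_subset (fun x hx => ?_) (fun x _ hx => ?_)
  · rw [Finset.mem_range] at *; omega
  · rw [Finset.mem_range] at hx
    rw [Nat.choose_eq_zero_of_lt (by omega)]; simp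

lemma double_int (κ₁ κ₂ R : ℝ) (h₁ : 0 < κ₁) (h₂ : 0 < κ₂) (E : ℝ → ℝ) (hE : Continuous E) (N : ℕ) :
    ∫ u in (-1:ℝ)..1, ∫ v in (-1:ℝ)..1, (E u + v * R)^N * wt κ₂ u * wt κ₁ v =
    ∑ j ∈ Finset.range (N+1), (N.choose (2*j) : ℝ) * (R^2)^j * Mv κ₁ (2*j) *
      ∫ u in (-1:ℝ)..1, (E u)^(N - 2*j) * wt κ₂ u := by
  simp_rw [inner_int κ₁ R _ _ h₁ N]
  rw [intervalIntegral.integral_finsetSum]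
  · simp_rw [intervalIntegral.integral_const_mul]
  · intro j _
    exact (wt_mul_integrable κ₂ h₂ _ (by fun_prop)).const_mul _

lemma inner_integrable (κ₁ κ₂ R : ℝ) (h₁ : 0 < κ₁) (h₂ : 0 < κ₂) (E : ℝ → ℝ) (hE : Continuous E)
    (N : ℕ) : IntervalIntegrable (fun u => ∫ v in (-1:ℝ)..1, (E u + v * R)^N * wt κ₂ u * wt κ₁ v)
      MeasureTheory.volume (-1) 1 := by
  simp_rw [inner_int κ₁ R _ _ h₁ N]
  have := IntervalIntegrable.sum (μ := MeasureTheory.volume) (a := -1) (b := 1) (Finset.range (N+1))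
    (f := fun j u => ((N.choose (2*j) : ℝ) * (R^2)^j * Mv κ₁ (2*j)) *
        (E u^(N - 2*j) * wt κ₂ u))
    (fun j _ => (wt_mul_integrable κ₂ h₂ _ (by fun_prop)).const_mul _)
  have e : (fun u => ∑ j ∈ Finset.range (N+1), (N.choose (2*j) : ℝ) * (R^2)^j * Mv κ₁ (2*j) *
        (E u^(N - 2*j) * wt κ₂ u)) = ∑ j ∈ Finset.range (N+1),
        fun u => (N.choose (2*j) : ℝ) * (R^2)^j * Mv κ₁ (2*j) * (E u^(N - 2*j) * wt κ₂ u) := by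
    funext u; simp
  exact e ▸ this

/-- LHS term -/
noncomputable def tt (k μ a b c d : ℝ) (l m : ℕ) : ℝ :=
  (a*b*c*d)^l / (poch (μ - k) l * poch μ (l+m) * (l.factorial : ℝ) * poch (k + 1 + m) l *
    (m.factorial : ℝ)) * (JackP k m 0 a b * (Mo k c d m 0 / Mo k c d 0 0))

lemma degree_term (κ₁ k μ a b c d R : ℝ) (h₁ : 0 < κ₁) (hk : 0 < k) (hμ : μ = κ₁ + k + 1/2)
    (hR : R ^ 2 = 4 * (a*b*c*d)) (N : ℕ) :
    (∫ u in (-1:ℝ)..1, ∫ v in (-1:ℝ)..1, ((a * ((c + d) / 2 + u * (c - d) / 2) +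
      b * ((c + d) / 2 - u * (c - d) / 2)) + v * R)^N * wt k u * wt κ₁ v) /
      (Mv κ₁ 0 * Mo k c d 0 0) / (poch μ N * (N.factorial : ℝ)) =
    ∑ l ∈ Finset.range (N+1), if 2 * l ≤ N then tt k μ a b c d l (N - 2*l) else 0 := by
  rw [double_int κ₁ k R h₁ hk (fun u => a * ((c + d) / 2 + u * (c - d) / 2) +
      b * ((c + d) / 2 - u * (c - d) / 2)) (by fun_prop)]
  have hμ0 : 0 < μ := by rw [hμ]; positivity
  have hμk : 0 < κ₁ + 1/2 := by positivity
  have hP := poch_pos hμ0 N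
  have hW := Mo_zero_pos k c d hk
  have hV : 0 < Mv κ₁ 0 := by
    have := Mo_zero_pos κ₁ 0 0 h₁
    simpa [Mo, Mv] using this
  have hN := Nat.factorial_pos N
  let f : ℕ → ℕ → ℝ := fun j i => (a*b*c*d)^j / ((j.factorial : ℝ) * poch (κ₁ + 1/2) j) *
    ((a*b*c*d)^i / ((i.factorial : ℝ) *
        poch (k + (((N:ℤ) - 2*j - 2*i : ℤ) : ℝ) + 1) i) * Dz k a b c d ((N:ℤ) - 2*j - 2 * i))
  have s1 : (∑ j ∈ Finset.range (N+1), (N.choose (2*j) : ℝ) * (R^2)^j * Mv κ₁ (2*j) *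
      ∫ u in (-1:ℝ)..1, (a * ((c + d) / 2 + u * (c - d) / 2) +
      b * ((c + d) / 2 - u * (c - d) / 2))^(N - 2*j) * wt k u) /
      (Mv κ₁ 0 * Mo k c d 0 0) / (poch μ N * (N.factorial : ℝ)) =
      (∑ j ∈ Finset.range (N+1), ∑ i ∈ Finset.range (N+1-j), f j i) / poch μ N := by
    rw [Finset.sum_div, Finset.sum_div, Finset.sum_div]
    refine Finset.sum_congr rfl fun j _ => ?_
    simp only [f]
    rw [← Finset.mul_sum]
    rcases lt_or_ge N (2*j) with h | h
    · rw [Nat.choose_eq_zero_of_lt h, Finset.sum_eq_zero]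
      · simp
      · intro i _
        rw [Dz, if_pos (by omega)]; simp
    · have hq := Q_expand k a b c d hk (N - 2*j) (N+1-j) (by omega)
      rw [show ((N - 2*j : ℕ) : ℤ) = (N:ℤ) - 2*j by omega] at hq
      rw [← hq, hR, Nat.cast_choose ℝ h, mul_pow]
      have hm := Mv_even κ₁ h₁ j
      have hpj := poch_pos hμk j
      have := Nat.factorial_pos j
      have := Nat.factorial_pos (2*j)
      have := Nat.factorial_pos (N-2*j)
      have hm' : Mv κ₁ (2*j) = Mv κ₁ 0 / ((j.factorial : ℝ) * poch (κ₁ + 1/2) j) * ((2*j).factorial : ℝ) / 4^j := by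
        rw [← hm]; field_simp
      rw [hm']
      have hQ : (∫ u in (-1:ℝ)..1, (a * ((c + d) / 2 + u * (c - d) / 2) +
        b * ((c + d) / 2 - u * (c - d) / 2))^(N - 2*j) * wt k u) = Qi k a b c d (N - 2*j) := rfl
      rw [hQ]
      generalize poch (κ₁ + 1/2) j = P at *
      field_simp
  rw [s1, ← Finset.sum_range_diag_flip, Finset.sum_div]
  refine Finset.sum_congr rfl fun l _ => ?_
  split_ifs with h
  · obtain ⟨m, rfl⟩ : ∃ m, N = m + 2 * l := ⟨N - 2*l, by omega⟩
    have hv := vandermonde_poch l (κ₁ + 1/2) (k + 1 + m) hμk (by positivity)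
    have e : ∀ j ∈ Finset.range (l+1), f j (l - j) = (a*b*c*d)^l / (l.factorial : ℝ) *
        Dz k a b c d m * ((l.choose j : ℝ) / (poch (κ₁ + 1/2) j * poch (k + 1 + m) (l - j))) := by
      intro j hj
      have hj' := Nat.lt_succ_iff.1 (Finset.mem_range.1 hj)
      simp only [f]
      rw [show ((m + 2 * l : ℕ) : ℤ) - 2 * j - 2 * ((l - j : ℕ) : ℤ) = (m:ℤ) by omega,
        Nat.cast_choose ℝ hj', Int.cast_natCast, add_right_comm k]
      have hpj := poch_pos hμk j
      have := poch_pos (show 0 < k + 1 + (m:ℝ) by positivity) (l-j)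
      have := Nat.factorial_pos j
      have := Nat.factorial_pos l
      have := Nat.factorial_pos (l-j)
      have ee : (a*b*c*d)^l = (a*b*c*d)^j * (a*b*c*d)^(l-j) := by rw [← pow_add]; congr 1; omega
      rw [ee]
      field_simp
    rw [Finset.sum_congr rfl e, ← Finset.mul_sum, hv, Nat.add_sub_cancel]
    unfold tt Dz
    rw [if_neg (by omega), Int.toNat_natCast, show m + 2 * l = (l + m) + l by ring, poch_add μ (l+m) l,
      show κ₁ + 1/2 + (k + 1 + m) + l - 1 = μ + ((l+m:ℕ):ℝ) by rw [hμ]; push_cast; ring,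
      show μ - k = κ₁ + 1/2 by rw [hμ]; ring]
    have := poch_pos hμk l
    have := poch_pos hμ0 (l+m)
    have := poch_pos (show 0 < μ + ((l+m:ℕ):ℝ) by positivity) l
    have := poch_pos (show 0 < k + 1 + (m:ℝ) by positivity) l
    have := Nat.factorial_pos l
    have := Nat.factorial_pos m
    field_simp
  · rw [Finset.sum_eq_zero, zero_div]
    intro j hj
    have hj' := Nat.lt_succ_iff.1 (Finset.mem_range.1 hj)
    simp only [f]
    rw [Dz, if_pos (by omega)]; simp

open Real

lemma poch_lower {μ : ℝ} (hμ : 0 < μ) (N : ℕ) : min 1 μ ≤ poch μ N := by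
  rcases N with _ | N
  · simp [poch]
  · rw [poch_succ_left]
    have : 1 ≤ poch (μ+1) N := by
      induction N with
      | zero => simp [poch]
      | succ N ih =>
        rw [poch_succ]
        have : (0:ℝ) ≤ N := by positivity
        nlinarith
    have := min_le_right 1 μ
    nlinarith

lemma summable_e {μ : ℝ} (hμ : 0 < μ) (B : ℝ) (hB : 0 ≤ B) :
    Summable fun N : ℕ => B ^ N / (poch μ N * (N.factorial : ℝ)) := by
  have hd : 0 < min 1 μ := by positivity
  refine Summable.of_nonneg_of_le (fun N => ?_) (fun N => ?_)
    ((Real.summable_pow_div_factorial B).mul_left (1 / min 1 μ))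
  · have := poch_pos hμ N; positivity
  · have h1 := poch_lower hμ N
    have := Nat.factorial_pos N
    rw [one_div_mul_eq_div, div_div, mul_comm (N.factorial : ℝ)]
    gcongr

lemma bessel_eq {μ Z : ℝ} (hμ : 0 < μ) (hZ : 0 ≤ Z) :
    besselI (μ - 1) (√(Z / 2)) = ∑' N : ℕ, (Z / 8) ^ N / (poch μ N * (N.factorial : ℝ)) := by
  unfold besselI
  rw [← tsum_mul_left]
  refine tsum_congr fun N => ?_
  have e : (√(Z/2) / 2) ^ (2 * N) = (Z/8)^N := by
    rw [pow_mul, div_pow, Real.sq_sqrt (by positivity)]; congr 1; ring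
  rw [e, show (N:ℝ) + (μ - 1) + 1 = μ + N by ring, Gamma_add_poch hμ, sub_add_cancel]
  have := Gamma_pos_of_pos hμ
  have := poch_pos hμ N
  have := Nat.factorial_pos N
  field_simp

lemma wt_nonneg (k u : ℝ) (hu : u ∈ Set.uIoc (-1:ℝ) 1) : 0 ≤ wt k u := by
  rw [Set.uIoc_of_le (by norm_num)] at hu
  exact Real.rpow_nonneg (by nlinarith [hu.1, hu.2]) _

lemma hasSum_swap (κ₁ κ₂ μ R : ℝ) (h₁ : 0 < κ₁) (h₂ : 0 < κ₂) (hμ : 0 < μ) (E : ℝ → ℝ)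
    (hE : Continuous E) :
    HasSum (fun N : ℕ => (∫ u in (-1:ℝ)..1, ∫ v in (-1:ℝ)..1, (E u + v * R)^N * wt κ₂ u * wt κ₁ v) /
      (poch μ N * (N.factorial : ℝ)))
     (∫ u in (-1:ℝ)..1, ∫ v in (-1:ℝ)..1,
      (∑' N : ℕ, (E u + v * R)^N / (poch μ N * (N.factorial : ℝ))) * wt κ₂ u * wt κ₁ v) := by
  obtain ⟨B0, hB0⟩ := (isCompact_uIcc (a := (-1:ℝ)) (b := 1)).exists_bound_of_continuousOn hE.continuousOn
  have hB0' : 0 ≤ B0 := (norm_nonneg _).trans (hB0 0 (by rw [Set.uIcc_of_le (by norm_num)]; norm_num))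
  let B := B0 + |R|
  have hB : 0 ≤ B := by positivity
  have hb : ∀ u ∈ Set.uIoc (-1:ℝ) 1, ∀ v ∈ Set.uIoc (-1:ℝ) 1, |E u + v * R| ≤ B := by
    intro u hu v hv
    have h1 := hB0 u (Set.uIoc_subset_uIcc hu)
    rw [Set.uIoc_of_le (by norm_num)] at hv
    have h2 : |v| ≤ 1 := abs_le.2 ⟨hv.1.le, hv.2⟩
    calc |E u + v * R| ≤ |E u| + |v * R| := abs_add_le _ _
      _ ≤ B0 + |R| := by
        rw [abs_mul]
        have : |v| * |R| ≤ 1 * |R| := by gcongr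
        have h3 : |E u| ≤ B0 := h1
        linarith
  have hep : ∀ N : ℕ, 0 < poch μ N * (N.factorial : ℝ) := fun N => by
    have := poch_pos hμ N; have := Nat.factorial_pos N; positivity
  have hs := summable_e hμ B hB
  have hterm : ∀ u ∈ Set.uIoc (-1:ℝ) 1, ∀ v ∈ Set.uIoc (-1:ℝ) 1, ∀ N : ℕ,
      |(E u + v * R)^N / (poch μ N * (N.factorial : ℝ))| ≤ B ^ N / (poch μ N * (N.factorial : ℝ)) := by
    intro u hu v hv N
    rw [abs_div, abs_of_pos (hep N), abs_pow]
    have := hep N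
    have := hb u hu v hv
    gcongr
  have hsum : ∀ u ∈ Set.uIoc (-1:ℝ) 1, ∀ v ∈ Set.uIoc (-1:ℝ) 1,
      Summable fun N : ℕ => (E u + v * R)^N / (poch μ N * (N.factorial : ℝ)) := fun u hu v hv =>
    Summable.of_norm_bounded hs (hterm u hu v hv)
  have hnorm : ∀ u ∈ Set.uIoc (-1:ℝ) 1, ∀ v ∈ Set.uIoc (-1:ℝ) 1, ∀ N : ℕ,
      ‖(E u + v * R)^N / (poch μ N * (N.factorial : ℝ)) * wt κ₂ u * wt κ₁ v‖ ≤
        B ^ N / (poch μ N * (N.factorial : ℝ)) * (wt κ₂ u * wt κ₁ v) := by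
    intro u hu v hv N
    rw [mul_assoc, norm_mul]
    have w1 := wt_nonneg κ₂ u hu
    have w2 := wt_nonneg κ₁ v hv
    rw [Real.norm_of_nonneg (mul_nonneg w1 w2)]
    exact mul_le_mul_of_nonneg_right (hterm u hu v hv N) (mul_nonneg w1 w2)
  have hii : ∀ u (N : ℕ), IntervalIntegrable (fun v => (E u + v * R)^N / (poch μ N * (N.factorial : ℝ)) *
      wt κ₂ u * wt κ₁ v) MeasureTheory.volume (-1) 1 := fun u N =>
    wt_mul_integrable κ₁ h₁ _ (by fun_prop)
  have inner : ∀ u ∈ Set.uIoc (-1:ℝ) 1,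
      HasSum (fun N : ℕ => ∫ v in (-1:ℝ)..1, (E u + v * R)^N / (poch μ N * (N.factorial : ℝ)) *
        wt κ₂ u * wt κ₁ v) (∫ v in (-1:ℝ)..1,
      (∑' N : ℕ, (E u + v * R)^N / (poch μ N * (N.factorial : ℝ))) * wt κ₂ u * wt κ₁ v) := by
    intro u hu
    refine intervalIntegral.hasSum_integral_of_dominated_convergence
      (fun N v => B ^ N / (poch μ N * (N.factorial : ℝ)) * (wt κ₂ u * wt κ₁ v)) ?_ ?_ ?_ ?_ ?_
    · intro N
      exact (intervalIntegrable_iff.1 (hii u N)).aestronglyMeasurable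
    · intro N
      exact Filter.Eventually.of_forall fun v hv => hnorm u hu v hv N
    · exact Filter.Eventually.of_forall fun v hv => hs.mul_right _
    · simp_rw [tsum_mul_right]
      exact ((wt_integrable κ₁ h₁).const_mul _).const_mul _
    · exact Filter.Eventually.of_forall fun v hv => ((hsum u hu v hv).hasSum.mul_right _).mul_right _
  have eqN : ∀ u (N : ℕ), ∫ v in (-1:ℝ)..1, (E u + v * R)^N / (poch μ N * (N.factorial : ℝ)) *
        wt κ₂ u * wt κ₁ v = (∫ v in (-1:ℝ)..1, (E u + v * R)^N * wt κ₂ u * wt κ₁ v) /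
        (poch μ N * (N.factorial : ℝ)) := by
    intro u N
    rw [← intervalIntegral.integral_div]
    refine intervalIntegral.integral_congr fun v _ => ?_
    ring
  have outer := intervalIntegral.hasSum_integral_of_dominated_convergence
      (μ := MeasureTheory.volume) (a := -1) (b := 1)
      (F := fun (N : ℕ) u => ∫ v in (-1:ℝ)..1, (E u + v * R)^N / (poch μ N * (N.factorial : ℝ)) *
        wt κ₂ u * wt κ₁ v)
      (f := fun u => ∫ v in (-1:ℝ)..1,
      (∑' N : ℕ, (E u + v * R)^N / (poch μ N * (N.factorial : ℝ))) * wt κ₂ u * wt κ₁ v)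
      (fun N u => B ^ N / (poch μ N * (N.factorial : ℝ)) * (wt κ₂ u * ∫ v in (-1:ℝ)..1, wt κ₁ v)) 
      ?_ ?_ ?_ ?_ ?_
  · refine outer.congr_fun ?_
    intro N
    simp_rw [eqN]
    rw [intervalIntegral.integral_div]
  · intro N
    simp_rw [eqN]
    exact (intervalIntegrable_iff.1 ((inner_integrable κ₁ κ₂ R h₁ h₂ E hE N).div_const _)).aestronglyMeasurable
  · intro N
    refine Filter.Eventually.of_forall fun u hu => ?_
    rw [← intervalIntegral.integral_const_mul, ← intervalIntegral.integral_const_mul]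
    refine intervalIntegral.norm_integral_le_of_norm_le (by norm_num) ?_ ?_
    · refine Filter.Eventually.of_forall fun v hv => ?_
      exact hnorm u hu v (by rw [Set.uIoc_of_le (by norm_num)]; exact hv) N
    · exact ((wt_integrable κ₁ h₁).const_mul _).const_mul _
  · exact Filter.Eventually.of_forall fun v hv => hs.mul_right _
  · simp_rw [tsum_mul_right]
    exact ((wt_integrable κ₂ h₂).mul_const _).const_mul _
  · exact Filter.Eventually.of_forall inner

lemma sum_reorder (t : ℕ → ℕ → ℝ) (ht : ∀ l m, 0 ≤ t l m) (S : ℝ)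
    (h : HasSum (fun N : ℕ => ∑ l ∈ Finset.range (N+1), if 2 * l ≤ N then t l (N - 2*l) else 0) S) :
    (∀ l, Summable (t l)) ∧ Summable (fun l => ∑' m, t l m) ∧ ∑' l, ∑' m, t l m = S := by
  obtain ⟨T, hT⟩ : ∃ T : ℕ × ℕ → ℝ, ∀ N l, T (N, l) = if 2 * l ≤ N then t l (N - 2*l) else 0 :=
    ⟨fun p => if 2 * p.2 ≤ p.1 then t p.2 (p.1 - 2*p.2) else 0, fun _ _ => rfl⟩
  have hT0 : 0 ≤ T := by
    rintro ⟨N, l⟩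
    rw [hT, Pi.zero_apply]
    split_ifs
    · exact ht _ _
    · exact le_refl _
  have hfin : ∀ N, HasSum (fun l => T (N, l))
      (∑ l ∈ Finset.range (N+1), if 2 * l ≤ N then t l (N - 2*l) else 0) := by
    intro N
    simp_rw [← hT]
    refine hasSum_sum_of_ne_finset_zero ?_
    intro l hl
    rw [Finset.mem_range] at hl
    rw [hT, if_neg (by omega)]
  have hTs : Summable T := by
    rw [summable_prod_of_nonneg hT0]
    refine ⟨fun N => (hfin N).summable, ?_⟩
    simp_rw [fun N => (hfin N).tsum_eq]
    exact h.summable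
  have hTS : HasSum T S := by
    have := hTs.hasSum.prod_fiberwise hfin
    rw [← this.unique h]; exact hTs.hasSum
  have hsw : HasSum (fun p : ℕ × ℕ => T (p.2, p.1)) S := (Equiv.prodComm ℕ ℕ).hasSum_iff.2 hTS
  have hcol : ∀ l, HasSum (fun N => T (N, l)) (∑' m, t l m) ∧ Summable (t l) := by
    intro l
    have hs : Summable (fun N => T (N, l)) := hsw.summable.prod_factor l
    have hinj : Function.Injective (fun m : ℕ => m + 2 * l) := fun a b hab => by simpa using hab
    have hz : ∀ x ∉ Set.range (fun m : ℕ => m + 2 * l), T (x, l) = 0 := by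
      intro x hx
      rw [hT, if_neg]
      intro hle
      exact hx ⟨x - 2 * l, by simp only; omega⟩
    have hcomp : (fun N => T (N, l)) ∘ (fun m : ℕ => m + 2 * l) = t l := by
      funext m; simp [hT]
    have h1 := (hinj.hasSum_iff (f := fun N => T (N, l)) hz).2 hs.hasSum
    rw [hcomp] at h1
    refine ⟨?_, h1.summable⟩
    rw [h1.tsum_eq]; exact hs.hasSum
  have hfinal := hsw.prod_fiberwise (fun l => (hcol l).1)
  exact ⟨fun l => (hcol l).2, hfinal.summable, hfinal.tsum_eq⟩

lemma gz_nonneg (k : ℝ) (hk : 0 < k) (n : ℤ) : 0 ≤ gz k n := by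
  unfold gz
  split_ifs
  · exact le_refl _
  · have := poch_pos hk n.toNat; positivity

lemma JackP_nonneg (k a b : ℝ) (hk : 0 < k) (ha : 0 ≤ a) (hb : 0 ≤ b) (m : ℕ) :
    0 ≤ JackP k m 0 a b := by
  rw [JackP_eq k a b hk]
  have := poch_pos hk m
  refine mul_nonneg (by positivity) (Finset.sum_nonneg fun j _ => ?_)
  have := gz_nonneg k hk j
  have := gz_nonneg k hk ((m - j : ℕ) : ℤ)
  positivity

lemma tt_nonneg (k μ a b c d : ℝ) (hk : 0 < k) (hμ : 0 < μ) (hμk : 0 < μ - k)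
    (ha : 0 ≤ a) (hb : 0 ≤ b) (hc : 0 ≤ c) (hd : 0 ≤ d) (l m : ℕ) : 0 ≤ tt k μ a b c d l m := by
  unfold tt
  rw [← Jack_ratio k c d hk]
  have := JackP_nonneg k a b hk ha hb m
  have := JackP_nonneg k c d hk hc hd m
  have := JackP_nonneg k 1 1 hk (by norm_num) (by norm_num) m
  have := poch_pos hμ (l+m)
  have := poch_pos hμk l
  have := poch_pos (show 0 < k + 1 + (m:ℝ) by positivity) l
  positivity

lemma tt_eq (k μ x₁ x₂ y₁ y₂ : ℝ) (hk : 0 < k) (hμ : 0 < μ) (hμk : 0 < μ - k) (ℓ m : ℕ) :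
    (x₁ ^ 2 * x₂ ^ 2 * y₁ ^ 2 * y₂ ^ 2 / 16) ^ ℓ /
          ((Real.Gamma (μ - k + ℓ) / Real.Gamma (μ - k)) *
            (Real.Gamma (μ + ℓ) / Real.Gamma μ) * (ℓ.factorial : ℝ) *
            (Real.Gamma (μ + ℓ + m) / Real.Gamma (μ + ℓ)) *
            (Real.Gamma (k + 1 + m + ℓ) / Real.Gamma (k + 1 + m)) * (m.factorial : ℝ)) *
        (JackP k m 0 (x₁ ^ 2 / 2) (x₂ ^ 2 / 2) * JackP k m 0 (y₁ ^ 2 / 2) (y₂ ^ 2 / 2) /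
          JackP k m 0 1 1) =
      tt k μ (x₁ ^ 2 / 2) (x₂ ^ 2 / 2) (y₁ ^ 2 / 2) (y₂ ^ 2 / 2) ℓ m := by
  have g : ∀ x : ℝ, 0 < x → ∀ n : ℕ, Gamma (x + n) / Gamma x = poch x n := by
    intro x hx n
    rw [Gamma_add_poch hx, mul_div_assoc, div_self (Gamma_pos_of_pos hx).ne', mul_one]
  rw [g _ hμk, g _ hμ, g (μ + ℓ) (by positivity), g (k + 1 + m) (by positivity)]
  unfold tt
  rw [mul_div_assoc (JackP k m 0 (x₁ ^ 2 / 2) (x₂ ^ 2 / 2)), Jack_ratio k _ _ hk, poch_add]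
  congr 2
  · ring
  · ring

/-- Integral representation of the generalized Bessel function of type `B₂`. -/
theorem generalized_bessel_B2_integral_representation
    (κ₁ κ₂ : ℝ) (hκ₁ : 0 < κ₁) (hκ₂ : 0 < κ₂)
    (k μ : ℝ) (hkdef : k = κ₂) (hμdef : μ = κ₁ + κ₂ + 1 / 2)
    (x₁ x₂ y₁ y₂ : ℝ) (hx₁ : 0 ≤ x₁) (hx₂ : 0 ≤ x₂) (hy₁ : 0 ≤ y₁) (hy₂ : 0 ≤ y₂) :
    (∀ ℓ : ℕ, Summable (fun m : ℕ =>
      (x₁ ^ 2 * x₂ ^ 2 * y₁ ^ 2 * y₂ ^ 2 / 16) ^ ℓ /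
          ((Real.Gamma (μ - k + ℓ) / Real.Gamma (μ - k)) *
            (Real.Gamma (μ + ℓ) / Real.Gamma μ) * (ℓ.factorial : ℝ) *
            (Real.Gamma (μ + ℓ + m) / Real.Gamma (μ + ℓ)) *
            (Real.Gamma (k + 1 + m + ℓ) / Real.Gamma (k + 1 + m)) * (m.factorial : ℝ)) *
        (JackP k m 0 (x₁ ^ 2 / 2) (x₂ ^ 2 / 2) * JackP k m 0 (y₁ ^ 2 / 2) (y₂ ^ 2 / 2) /
          JackP k m 0 1 1))) ∧
    Summable (fun ℓ : ℕ => ∑' m : ℕ,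
      (x₁ ^ 2 * x₂ ^ 2 * y₁ ^ 2 * y₂ ^ 2 / 16) ^ ℓ /
          ((Real.Gamma (μ - k + ℓ) / Real.Gamma (μ - k)) *
            (Real.Gamma (μ + ℓ) / Real.Gamma μ) * (ℓ.factorial : ℝ) *
            (Real.Gamma (μ + ℓ + m) / Real.Gamma (μ + ℓ)) *
            (Real.Gamma (k + 1 + m + ℓ) / Real.Gamma (k + 1 + m)) * (m.factorial : ℝ)) *
        (JackP k m 0 (x₁ ^ 2 / 2) (x₂ ^ 2 / 2) * JackP k m 0 (y₁ ^ 2 / 2) (y₂ ^ 2 / 2) /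
          JackP k m 0 1 1)) ∧
    (∑' ℓ : ℕ, ∑' m : ℕ,
      (x₁ ^ 2 * x₂ ^ 2 * y₁ ^ 2 * y₂ ^ 2 / 16) ^ ℓ /
          ((Real.Gamma (μ - k + ℓ) / Real.Gamma (μ - k)) *
            (Real.Gamma (μ + ℓ) / Real.Gamma μ) * (ℓ.factorial : ℝ) *
            (Real.Gamma (μ + ℓ + m) / Real.Gamma (μ + ℓ)) *
            (Real.Gamma (k + 1 + m + ℓ) / Real.Gamma (k + 1 + m)) * (m.factorial : ℝ)) *
        (JackP k m 0 (x₁ ^ 2 / 2) (x₂ ^ 2 / 2) * JackP k m 0 (y₁ ^ 2 / 2) (y₂ ^ 2 / 2) /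
          JackP k m 0 1 1)) =
      (Real.Gamma (κ₁ + 1 / 2) * Real.Gamma (κ₂ + 1 / 2) /
          (Real.pi * Real.Gamma κ₁ * Real.Gamma κ₂)) *
        ∫ u in (-1 : ℝ)..1, ∫ v in (-1 : ℝ)..1,
          besselI (μ - 1)
              (Real.sqrt (((x₁ ^ 2 + x₂ ^ 2) * (y₁ ^ 2 + y₂ ^ 2) +
                u * (x₁ ^ 2 - x₂ ^ 2) * (y₁ ^ 2 - y₂ ^ 2) +
                4 * v * x₁ * x₂ * y₁ * y₂) / 2)) *
            (1 - u ^ 2) ^ (κ₂ - 1) * (1 - v ^ 2) ^ (κ₁ - 1) := by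
  subst hkdef
  have hμ0 : 0 < μ := by rw [hμdef]; positivity
  have hμk : 0 < μ - k := by rw [hμdef]; linarith
  simp only [tt_eq k μ x₁ x₂ y₁ y₂ hκ₂ hμ0 hμk]
  refine sum_reorder (tt k μ (x₁ ^ 2 / 2) (x₂ ^ 2 / 2) (y₁ ^ 2 / 2) (y₂ ^ 2 / 2))
    (fun l m => tt_nonneg k μ _ _ _ _ hκ₂ hμ0 hμk (by positivity) (by positivity) (by positivity)
      (by positivity) l m) _ ?_
  have hR : (x₁ * x₂ * y₁ * y₂ / 2) ^ 2 = 4 * (x₁ ^ 2 / 2 * (x₂ ^ 2 / 2) * (y₁ ^ 2 / 2) * (y₂ ^ 2 / 2)) := by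
    ring
  have hd := fun N => degree_term κ₁ k μ (x₁ ^ 2 / 2) (x₂ ^ 2 / 2) (y₁ ^ 2 / 2) (y₂ ^ 2 / 2)
    (x₁ * x₂ * y₁ * y₂ / 2) hκ₁ hκ₂ hμdef hR N
  simp_rw [← hd]
  have hs := hasSum_swap κ₁ k μ (x₁ * x₂ * y₁ * y₂ / 2) hκ₁ hκ₂ hμ0
    (fun u => (x₁ ^ 2 / 2) * ((y₁ ^ 2 / 2 + y₂ ^ 2 / 2) / 2 + u * (y₁ ^ 2 / 2 - y₂ ^ 2 / 2) / 2) +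
      (x₂ ^ 2 / 2) * ((y₁ ^ 2 / 2 + y₂ ^ 2 / 2) / 2 - u * (y₁ ^ 2 / 2 - y₂ ^ 2 / 2) / 2)) (by fun_prop)
  have hc : Real.Gamma (κ₁ + 1 / 2) * Real.Gamma (k + 1 / 2) /
      (Real.pi * Real.Gamma κ₁ * Real.Gamma k) = 1 / (Mv κ₁ 0 * Mo k (y₁ ^ 2 / 2) (y₂ ^ 2 / 2) 0 0) := by
    have e1 : Mv κ₁ 0 = √π * Gamma κ₁ / Gamma (κ₁ + 1/2) := by
      rw [← wt_integral' κ₁ hκ₁]; simp [Mv]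
    have e2 : Mo k (y₁ ^ 2 / 2) (y₂ ^ 2 / 2) 0 0 = √π * Gamma k / Gamma (k + 1/2) := by
      rw [← wt_integral' k hκ₂]; simp [Mo]
    rw [e1, e2]
    have h1 := Gamma_pos_of_pos hκ₁
    have h2 := Gamma_pos_of_pos hκ₂
    have h3 := Gamma_pos_of_pos (show 0 < κ₁ + 1/2 by linarith)
    have h4 := Gamma_pos_of_pos (show 0 < k + 1/2 by linarith)
    have h5 : √π * √π = π := Real.mul_self_sqrt Real.pi_pos.le
    rw [div_mul_div_comm, one_div_div]
    congr 1
    linear_combination (-(Gamma κ₁ * Gamma k)) * h5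
  rw [hc]
  have hbi : (∫ u in (-1 : ℝ)..1, ∫ v in (-1 : ℝ)..1,
          besselI (μ - 1)
              (Real.sqrt (((x₁ ^ 2 + x₂ ^ 2) * (y₁ ^ 2 + y₂ ^ 2) +
                u * (x₁ ^ 2 - x₂ ^ 2) * (y₁ ^ 2 - y₂ ^ 2) +
                4 * v * x₁ * x₂ * y₁ * y₂) / 2)) *
            (1 - u ^ 2) ^ (k - 1) * (1 - v ^ 2) ^ (κ₁ - 1)) =
      ∫ u in (-1:ℝ)..1, ∫ v in (-1:ℝ)..1,
      (∑' N : ℕ, (((x₁ ^ 2 / 2) * ((y₁ ^ 2 / 2 + y₂ ^ 2 / 2) / 2 + u * (y₁ ^ 2 / 2 - y₂ ^ 2 / 2) / 2) +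
      (x₂ ^ 2 / 2) * ((y₁ ^ 2 / 2 + y₂ ^ 2 / 2) / 2 - u * (y₁ ^ 2 / 2 - y₂ ^ 2 / 2) / 2))
        + v * (x₁ * x₂ * y₁ * y₂ / 2))^N / (poch μ N * (N.factorial : ℝ))) * wt k u * wt κ₁ v := by
    refine intervalIntegral.integral_congr fun u hu => ?_
    refine intervalIntegral.integral_congr fun v hv => ?_
    rw [Set.uIcc_of_le (by norm_num)] at hu hv
    have hZ : 0 ≤ (x₁ ^ 2 + x₂ ^ 2) * (y₁ ^ 2 + y₂ ^ 2) +
                u * (x₁ ^ 2 - x₂ ^ 2) * (y₁ ^ 2 - y₂ ^ 2) + 4 * v * x₁ * x₂ * y₁ * y₂ := by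
      have q : 0 ≤ x₁ * x₂ * y₁ * y₂ := by positivity
      have a1 : 0 ≤ (1 + u) * (x₁ * y₁ - x₂ * y₂) ^ 2 := mul_nonneg (by linarith [hu.1]) (sq_nonneg _)
      have a2 : 0 ≤ (1 - u) * (x₁ * y₂ - x₂ * y₁) ^ 2 := mul_nonneg (by linarith [hu.2]) (sq_nonneg _)
      have a3 : 0 ≤ (1 + v) * (x₁ * x₂ * y₁ * y₂) := mul_nonneg (by linarith [hv.1]) q
      nlinarith
    have hb := bessel_eq hμ0 hZ
    simp only [wt]
    rw [hb]
    congr 3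
    funext N
    congr 2
    ring
  rw [hbi]
  refine (hs.mul_left (1 / (Mv κ₁ 0 * Mo k (y₁ ^ 2 / 2) (y₂ ^ 2 / 2) 0 0))).congr_fun ?_
  intro N
  ring
end

section
/- (Poisson integral representation.) For every real k > 0 and every t ∈ ℝ, (Γ(k+1/2)/(√π Γ(k))) ∫_{−1}^{1} e^{tu} (1−u²)^{k−1} du = 𝓘_{k−1/2}(t), i.e. the left-hand side equals Γ(k+1/2) Σ_{m=0}^∞ (t/2)^{2m}/(m! Γ(m+k+1/2)). -/
open Real

open MeasureTheory Set

namespace PoissonAux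

lemma beta_ofReal (k x : ℝ) (hx : x ∈ Icc (0:ℝ) 1) :
    (x : ℂ) ^ ((k : ℂ) - 1) * (1 - (x : ℂ)) ^ ((k : ℂ) - 1)
      = ((x ^ (k - 1) * (1 - x) ^ (k - 1) : ℝ) : ℂ) := by
  have h1 : (0:ℝ) ≤ 1 - x := by linarith [hx.2]
  rw [Complex.ofReal_mul, Complex.ofReal_cpow hx.1, Complex.ofReal_cpow h1]
  push_cast
  rfl

lemma beta_int (k : ℝ) (hk : 0 < k) :
    IntervalIntegrable (fun x : ℝ => x ^ (k - 1) * (1 - x) ^ (k - 1)) volume 0 1 := by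
  have h := (Complex.betaIntegral_convergent (u := k) (v := k) (by simpa) (by simpa)).norm
  refine h.congr ?_
  intro x hx
  rw [uIoc_of_le zero_le_one] at hx
  have hx' : x ∈ Icc (0:ℝ) 1 := ⟨hx.1.le, hx.2⟩
  have h1 : (0:ℝ) ≤ 1 - x := by linarith [hx.2]
  have h0 : (0:ℝ) ≤ x := hx.1.le
  simp only
  rw [beta_ofReal k x hx', Complex.norm_real, Real.norm_of_nonneg (by positivity)]

lemma beta_val (k : ℝ) (hk : 0 < k) :
    ∫ x in (0:ℝ)..1, x ^ (k - 1) * (1 - x) ^ (k - 1)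
      = Real.Gamma k * Real.Gamma k / Real.Gamma (2 * k) := by
  have h := Complex.betaIntegral_eq_Gamma_mul_div k k (by simpa) (by simpa)
  rw [Complex.betaIntegral, intervalIntegral.integral_congr (g := fun x : ℝ =>
    ((x ^ (k - 1) * (1 - x) ^ (k - 1) : ℝ) : ℂ)), intervalIntegral.integral_ofReal,
    ← Complex.ofReal_add, Complex.Gamma_ofReal, Complex.Gamma_ofReal] at h
  · rw [two_mul]; exact_mod_cast h
  · intro x hx
    rw [uIcc_of_le zero_le_one] at hx
    exact beta_ofReal k x hx

lemma w_eq (k u : ℝ) (hu : u ∈ Icc (-1:ℝ) 1) :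
    (1 - u ^ 2) ^ (k - 1) = 4 ^ (k - 1) *
      ((1 / 2 * u + 1 / 2) ^ (k - 1) * (1 - (1 / 2 * u + 1 / 2)) ^ (k - 1)) := by
  have h1 : (0:ℝ) ≤ 1 / 2 * u + 1 / 2 := by linarith [hu.1]
  have h2 : (0:ℝ) ≤ 1 - (1 / 2 * u + 1 / 2) := by linarith [hu.2]
  rw [← Real.mul_rpow h1 h2, ← Real.mul_rpow (by norm_num) (by positivity)]
  congr 1
  ring

lemma w_int (k : ℝ) (hk : 0 < k) :
    IntervalIntegrable (fun u : ℝ => (1 - u ^ 2) ^ (k - 1)) volume (-1) 1 := by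
  have h := (((beta_int k hk).comp_mul_left (c := 1 / 2)).comp_add_right 1).const_mul
    ((4:ℝ) ^ (k - 1))
  norm_num at h
  refine h.congr ?_
  intro u hu
  rw [uIoc_of_le (by norm_num)] at hu
  simp only
  rw [w_eq k u ⟨hu.1.le, hu.2⟩]
  congr 3 <;> ring

lemma J_zero (k : ℝ) (hk : 0 < k) :
    ∫ u in (-1:ℝ)..1, (1 - u ^ 2) ^ (k - 1)
      = √π * Real.Gamma k / Real.Gamma (k + 1 / 2) := by
  rw [intervalIntegral.integral_congr (g := fun u : ℝ => 4 ^ (k - 1) *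
      ((1 / 2 * u + 1 / 2) ^ (k - 1) * (1 - (1 / 2 * u + 1 / 2)) ^ (k - 1)))]
  · rw [intervalIntegral.integral_const_mul,
      intervalIntegral.integral_comp_mul_add (a := -1) (b := 1)
      (f := fun x : ℝ => x ^ (k - 1) * (1 - x) ^ (k - 1)) (c := 1 / 2) (by norm_num) (1 / 2)]
    norm_num
    rw [beta_val k hk]
    have hd := Real.Gamma_mul_Gamma_add_half k
    have g1 := Real.Gamma_pos_of_pos hk
    have g2 : 0 < Real.Gamma (k + 1 / 2) := Real.Gamma_pos_of_pos (by linarith)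
    have g3 : 0 < Real.Gamma (2 * k) := Real.Gamma_pos_of_pos (by linarith)
    have h4 : (4:ℝ) ^ (k - 1) * 2 * 2 ^ (1 - 2 * k) = 1 := by
      have : (4:ℝ) = 2 ^ (2:ℝ) := by norm_num
      rw [this, ← Real.rpow_mul (by norm_num)]
      rw [mul_right_comm, ← Real.rpow_add (by norm_num),
        show (2:ℝ) * (k - 1) + (1 - 2 * k) = -1 by ring, Real.rpow_neg_one]
      norm_num
    rw [← mul_div_assoc, ← mul_div_assoc, div_eq_div_iff g3.ne' g2.ne']
    linear_combination (4:ℝ) ^ (k - 1) * 2 * Real.Gamma k * hd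
      + √π * Real.Gamma k * Real.Gamma (2 * k) * h4
  · intro u hu
    rw [uIcc_of_le (by norm_num)] at hu
    exact w_eq k u hu

lemma J_int (k : ℝ) (hk : 0 < k) (f : ℝ → ℝ) (hf : Continuous f) :
    IntervalIntegrable (fun u : ℝ => f u * (1 - u ^ 2) ^ (k - 1)) volume (-1) 1 :=
  (w_int k hk).continuousOn_mul hf.continuousOn

lemma J_odd (k : ℝ) (m : ℕ) :
    ∫ u in (-1:ℝ)..1, u ^ (2 * m + 1) * (1 - u ^ 2) ^ (k - 1) = 0 := by
  have h := intervalIntegral.integral_comp_neg (a := -1) (b := 1)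
    (fun u : ℝ => u ^ (2 * m + 1) * (1 - u ^ 2) ^ (k - 1))
  have e : ∀ u : ℝ, (-u) ^ (2 * m + 1) = - u ^ (2 * m + 1) := fun u =>
    Odd.neg_pow ⟨m, rfl⟩ u
  simp only [e, neg_sq, neg_neg, neg_mul, intervalIntegral.integral_neg] at h
  linarith

lemma J_rec (k : ℝ) (hk : 0 < k) (m : ℕ) :
    (2 * m + 1 + 2 * k) * ∫ u in (-1:ℝ)..1, u ^ (2 * (m + 1)) * (1 - u ^ 2) ^ (k - 1)
      = (2 * m + 1) * ∫ u in (-1:ℝ)..1, u ^ (2 * m) * (1 - u ^ 2) ^ (k - 1) := by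
  have i1 := (J_int k hk (fun u => u ^ (2 * m)) (by fun_prop)).const_mul (2 * (m:ℝ) + 1)
  have i2 := (J_int k hk (fun u => u ^ (2 * (m + 1))) (by fun_prop)).const_mul
    (2 * (m:ℝ) + 1 + 2 * k)
  have h := intervalIntegral.integral_eq_sub_of_hasDerivAt_of_le (a := -1) (b := 1)
    (f := fun u : ℝ => u ^ (2 * m + 1) * (1 - u ^ 2) ^ k) (by norm_num)
    (by
      apply Continuous.continuousOn
      exact (continuous_pow _).mul ((by fun_prop : Continuous fun u : ℝ => 1 - u ^ 2).rpow_const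
        (fun _ => Or.inr hk.le)))
    (by
      intro u hu
      have hp : 0 < 1 - u ^ 2 := by nlinarith [hu.1, hu.2]
      have d1 : HasDerivAt (fun u : ℝ => 1 - u ^ 2) (-(2 * u)) u := by
        simpa using (hasDerivAt_pow 2 u).const_sub 1
      have d2 := (hasDerivAt_pow (2 * m + 1) u).mul (d1.rpow_const (p := k) (Or.inl hp.ne'))
      refine d2.congr_deriv ?_
      have e : (1 - u ^ 2) ^ k = (1 - u ^ 2) ^ (k - 1) * (1 - u ^ 2) := by
        rw [← Real.rpow_add_one hp.ne']; simp
      rw [e]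
      push_cast
      change _ = (2 * (m:ℝ) + 1) * (u ^ (2 * m) * (1 - u ^ 2) ^ (k - 1)) -
        (2 * (m:ℝ) + 1 + 2 * k) * (u ^ (2 * (m + 1)) * (1 - u ^ 2) ^ (k - 1))
      ring) (i1.sub i2)
  rw [intervalIntegral.integral_sub i1 i2, intervalIntegral.integral_const_mul,
    intervalIntegral.integral_const_mul] at h
  norm_num [Real.zero_rpow hk.ne'] at h
  linarith

lemma J_even (k : ℝ) (hk : 0 < k) (m : ℕ) :
    ∫ u in (-1:ℝ)..1, u ^ (2 * m) * (1 - u ^ 2) ^ (k - 1)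
      = (2 * m).factorial * (√π * Real.Gamma k /
        (4 ^ m * m.factorial * Real.Gamma (m + k + 1 / 2))) := by
  induction m with
  | zero => simpa using J_zero k hk
  | succ m ih =>
    have h := J_rec k hk m
    rw [ih] at h
    have hp : (0:ℝ) < m + k + 1 / 2 := by positivity
    have g : Real.Gamma (((m + 1 : ℕ) : ℝ) + k + 1 / 2)
        = (m + k + 1 / 2) * Real.Gamma (m + k + 1 / 2) := by
      rw [← Real.Gamma_add_one hp.ne']; push_cast; ring_nf
    have gp := Real.Gamma_pos_of_pos hp
    have hc : (0:ℝ) < 2 * m + 1 + 2 * k := by positivity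
    apply mul_left_cancel₀ hc.ne'
    rw [h, g, show 2 * (m + 1) = 2 * m + 1 + 1 by ring, Nat.factorial_succ, Nat.factorial_succ,
      Nat.factorial_succ]
    push_cast
    have hf : (m.factorial : ℝ) ≠ 0 := by positivity
    generalize Real.Gamma (m + k + 1 / 2) = G at *
    have : (m:ℝ) + k + 1 / 2 = (2 * m + 1 + 2 * k) / 2 := by ring
    rw [this]
    field_simp
    ring

lemma exp_hasSum (k : ℝ) (hk : 0 < k) (t : ℝ) :
    HasSum (fun n : ℕ => t ^ n / n.factorial * ∫ u in (-1:ℝ)..1, u ^ n * (1 - u ^ 2) ^ (k - 1))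
      (∫ u in (-1:ℝ)..1, Real.exp (t * u) * (1 - u ^ 2) ^ (k - 1)) := by
  have hs : ∀ x : ℝ, HasSum (fun n : ℕ => x ^ n / n.factorial) (Real.exp x) := fun x => by
    rw [Real.exp_eq_exp_ℝ]; exact NormedSpace.expSeries_div_hasSum_exp x
  simp_rw [← intervalIntegral.integral_const_mul]
  refine intervalIntegral.hasSum_integral_of_dominated_convergence
    (fun n u => |t| ^ n / n.factorial * (1 - u ^ 2) ^ (k - 1)) ?_ ?_ ?_ ?_ ?_
  · intro n
    exact (intervalIntegrable_iff.1
      ((J_int k hk (fun u => u ^ n) (by fun_prop)).const_mul _)).aestronglyMeasurable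
  · intro n
    refine Filter.Eventually.of_forall fun u hu => ?_
    rw [uIoc_of_le (by norm_num)] at hu
    have hp : 0 ≤ 1 - u ^ 2 := by nlinarith [hu.1, hu.2]
    have hu1 : |u| ≤ 1 := abs_le.2 ⟨hu.1.le, hu.2⟩
    have hw := Real.rpow_nonneg hp (k - 1)
    rw [norm_mul, norm_mul, norm_div, norm_pow, norm_pow, Real.norm_of_nonneg hw]
    simp only [Real.norm_eq_abs, Nat.abs_cast]
    gcongr
    exact mul_le_of_le_one_left hw (pow_le_one₀ (abs_nonneg u) hu1)
  · exact Filter.Eventually.of_forall fun u _ => (hs |t|).summable.mul_right _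
  · simp_rw [tsum_mul_right]
    exact (w_int k hk).const_mul _
  · refine Filter.Eventually.of_forall fun u _ => ?_
    refine ((hs (t * u)).mul_right ((1 - u ^ 2) ^ (k - 1))).congr_fun ?_
    intro n
    rw [mul_pow]; ring

lemma main (k : ℝ) (hk : 0 < k) (t : ℝ) :
    (Real.Gamma (k + 1 / 2) / (Real.sqrt Real.pi * Real.Gamma k)) *
        ∫ u in (-1 : ℝ)..1, Real.exp (t * u) * (1 - u ^ 2) ^ (k - 1) =
      Real.Gamma (k + 1 / 2) *
        ∑' m : ℕ, (t / 2) ^ (2 * m) / ((m.factorial : ℝ) * Real.Gamma (m + k + 1 / 2)) := by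
  have h := exp_hasSum k hk t
  have hinj : Function.Injective (fun m : ℕ => 2 * m) := fun a b h => by simpa using h
  rw [← hinj.hasSum_iff] at h
  · have g1 := Real.Gamma_pos_of_pos hk
    have hpi : 0 < √π := Real.sqrt_pos.2 Real.pi_pos
    have h2 := h.mul_left ((√π * Real.Gamma k)⁻¹)
    rw [div_eq_mul_inv, mul_assoc, ← h2.tsum_eq]
    congr 1
    refine tsum_congr fun m => ?_
    simp only [Function.comp]
    rw [J_even k hk m]
    have gp : 0 < Real.Gamma (m + k + 1 / 2) := Real.Gamma_pos_of_pos (by positivity)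
    have e : (t / 2) ^ (2 * m) = t ^ (2 * m) / 4 ^ m := by
      rw [div_pow, pow_mul 2 2 m]; norm_num
    rw [e]
    have hf : ((2 * m).factorial : ℝ) ≠ 0 := by positivity
    field_simp
  · intro n hn
    rcases Nat.even_or_odd' n with ⟨m, rfl | rfl⟩
    · exact absurd ⟨m, rfl⟩ hn
    · rw [J_odd, mul_zero]

end PoissonAux

/-- Poisson integral representation of the normalized modified Bessel function. -/
theorem poisson_integral_representation (k : ℝ) (hk : 0 < k) (t : ℝ) :
    (Real.Gamma (k + 1 / 2) / (Real.sqrt Real.pi * Real.Gamma k)) *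
        ∫ u in (-1 : ℝ)..1, Real.exp (t * u) * (1 - u ^ 2) ^ (k - 1) =
      besselI (k - 1 / 2) t ∧
    (Real.Gamma (k + 1 / 2) / (Real.sqrt Real.pi * Real.Gamma k)) *
        ∫ u in (-1 : ℝ)..1, Real.exp (t * u) * (1 - u ^ 2) ^ (k - 1) =
      Real.Gamma (k + 1 / 2) *
        ∑' m : ℕ, (t / 2) ^ (2 * m) / ((m.factorial : ℝ) * Real.Gamma (m + k + 1 / 2)) := by
  have h := PoissonAux.main k hk t
  refine ⟨?_, h⟩
  rw [h, besselI]
  congr 1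
  · congr 1; ring
  · refine tsum_congr fun m => ?_
    congr 3; ring
end

section
/- (Product formula for the normalized modified Bessel function.) For every real k > 0 and all x,y ∈ ℝ, 𝓘_{k−1/2}(x) · 𝓘_{k−1/2}(y) = (Γ(k+1/2)/(√π Γ(k))) ∫_{−1}^{1} 𝓘_{k−1/2}(√(x² + y² + 2uxy)) (1−u²)^{k−1} du. (Note x² + y² + 2uxy ≥ 0 for u ∈ [−1,1].) -/
open Real

open Finset in
lemma aux_choose (c : ℝ) (hc : 0 < c) (j : ℕ) :
    Ring.choose (c + j - 1) j = Real.Gamma (j + c) / (Real.Gamma c * (j.factorial : ℝ)) := by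
  have h1 := Ring.factorial_nsmul_multichoose_eq_ascPochhammer c j
  rw [Ring.multichoose_eq, Polynomial.ascPochhammer_smeval_eq_eval, nsmul_eq_mul] at h1
  have h2 : ∀ n : ℕ, (ascPochhammer ℝ n).eval c * Real.Gamma c = Real.Gamma (n + c) := by
    intro n
    induction n with
    | zero => simp
    | succ n ih =>
      rw [ascPochhammer_succ_eval]
      have : ((n + 1 : ℕ) : ℝ) + c = (n + c) + 1 := by push_cast; ring
      rw [this, Real.Gamma_add_one (by positivity), ← ih]; ring
  have := (Real.Gamma_pos_of_pos hc).ne'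
  rw [← h2 j, ← h1]
  have : (j.factorial : ℝ) ≠ 0 := by positivity
  field_simp

open Finset in
lemma aux_vander (c : ℝ) (hc : 0 < c) (a b : ℕ) :
    ∑ p ∈ antidiagonal b, (a.choose p.1 : ℝ) / (Real.Gamma (p.1 + c) * (p.2.factorial : ℝ)) =
      Real.Gamma ((a + b : ℕ) + c) / (Real.Gamma (a + c) * Real.Gamma (b + c) * (b.factorial : ℝ)) := by
  have h := Ring.add_choose_eq (r := (a : ℝ)) (s := c + b - 1) b (Commute.all _ _)
  rw [show (a : ℝ) + (c + b - 1) = (a + c) + b - 1 by ring, aux_choose _ (by positivity)] at h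
  have hb := (Real.Gamma_pos_of_pos (show (0:ℝ) < b + c by positivity)).ne'
  have ha := (Real.Gamma_pos_of_pos (show (0:ℝ) < a + c by positivity)).ne'
  have : ∀ p ∈ antidiagonal b, Ring.choose (a : ℝ) p.1 * Ring.choose (c + b - 1) p.2 =
      Real.Gamma (b + c) * ((a.choose p.1 : ℝ) / (Real.Gamma (p.1 + c) * (p.2.factorial : ℝ))) := by
    intro p hp
    rw [HasAntidiagonal.mem_antidiagonal] at hp
    rw [Ring.choose_natCast]
    have e : c + (b : ℝ) - 1 = (p.1 + c) + p.2 - 1 := by rw [← hp]; push_cast; ring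
    rw [e, aux_choose _ (by positivity)]
    have e2 : (p.2 : ℝ) + (p.1 + c) = b + c := by rw [← hp]; push_cast; ring
    rw [e2]; ring
  rw [sum_congr rfl this, ← mul_sum] at h
  rw [show ((a + b : ℕ) : ℝ) + c = b + (a + c) by push_cast; ring]
  rw [← mul_right_inj' hb, ← h]
  field_simp

lemma aux_beta (α β : ℝ) (hα : 0 < α) (hβ : 0 < β) :
    ∫ x in (0:ℝ)..1, x ^ (α - 1) * (1 - x) ^ (β - 1) =
      Real.Gamma α * Real.Gamma β / Real.Gamma (α + β) := by
  have h := Complex.betaIntegral_eq_Gamma_mul_div α β (by simpa) (by simpa)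
  rw [← Complex.ofReal_add, Complex.Gamma_ofReal, Complex.Gamma_ofReal, Complex.Gamma_ofReal,
    Complex.betaIntegral] at h
  have : ∫ x in (0:ℝ)..1, (x : ℂ) ^ ((α : ℂ) - 1) * (1 - (x : ℂ)) ^ ((β : ℂ) - 1) =
      ((∫ x in (0:ℝ)..1, x ^ (α - 1) * (1 - x) ^ (β - 1) : ℝ) : ℂ) := by
    rw [← intervalIntegral.integral_ofReal]
    apply intervalIntegral.integral_congr
    intro x hx
    rw [Set.uIcc_of_le zero_le_one] at hx
    simp only
    push_cast
    rw [Complex.ofReal_cpow hx.1, Complex.ofReal_cpow (by linarith [hx.2])]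
    push_cast; rfl
  rw [this] at h
  exact_mod_cast h

open MeasureTheory in
lemma aux_half (k : ℝ) (hk : 0 < k) (i : ℕ) :
    ∫ u in (0:ℝ)..1, u ^ (2 * i) * (1 - u ^ 2) ^ (k - 1) =
      Real.Gamma (i + 1 / 2) * Real.Gamma k / Real.Gamma (i + (k + 1 / 2)) / 2 := by
  have h := aux_beta (i + 1 / 2) k (by positivity) hk
  rw [show (i : ℝ) + 1 / 2 + k = i + (k + 1/2) by ring] at h
  rw [← h]
  have h2 := integral_comp_rpow_Ioi_of_pos (p := 2) (by norm_num)
    (g := Set.indicator (Set.Ioc (0:ℝ) 1) (fun v => v ^ ((i:ℝ) + 1 / 2 - 1) * (1 - v) ^ (k - 1)))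
  rw [setIntegral_indicator measurableSet_Ioc, Set.inter_eq_self_of_subset_right
    (fun x hx => hx.1), ← intervalIntegral.integral_of_le zero_le_one] at h2
  rw [← h2, intervalIntegral.integral_of_le zero_le_one, eq_div_iff two_ne_zero,
    ← integral_mul_const]
  rw [← Set.inter_eq_self_of_subset_right (s := Set.Ioi (0:ℝ)) (t := Set.Ioc (0:ℝ) 1)
    (fun x hx => hx.1), ← setIntegral_indicator measurableSet_Ioc]
  apply setIntegral_congr_fun measurableSet_Ioi
  intro u hu
  have hu : 0 < u := hu
  simp only [Set.indicator, Set.mem_Ioc, smul_eq_mul]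
  rw [Real.rpow_two]
  by_cases h1 : u ≤ 1
  · have h3 : u ^ 2 ≤ 1 := by nlinarith
    rw [if_pos ⟨hu, h1⟩, if_pos ⟨pow_pos hu 2, pow_pos hu 2, h3⟩]
    have : (u ^ 2) ^ ((i : ℝ) + 1 / 2 - 1) * u = u ^ (2 * i) := by
      rw [← Real.rpow_two, ← Real.rpow_mul hu.le, ← Real.rpow_add_one hu.ne', ← Real.rpow_natCast]
      congr 1; push_cast; ring
    rw [← this]
    norm_num
    ring
  · have h3 : ¬ u ^ 2 ≤ 1 := by nlinarith
    rw [if_neg (fun h => h1 h.2), if_neg (fun h => h3 h.2.2)]; simp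

lemma aux_intble (k : ℝ) (hk : 0 < k) :
    IntervalIntegrable (fun u : ℝ => (1 - u ^ 2) ^ (k - 1)) MeasureTheory.volume (-1) 1 := by
  have key : IntervalIntegrable (fun u : ℝ => (1 - u ^ 2) ^ (k - 1)) MeasureTheory.volume 0 1 := by
    have h1 : IntervalIntegrable (fun u : ℝ => (1 - u) ^ (k - 1)) MeasureTheory.volume 0 1 := by
      have := (intervalIntegral.intervalIntegrable_rpow' (a := 1) (b := 0)
        (r := k - 1) (by linarith)).comp_sub_left 1
      simpa using this
    have h2 : ContinuousOn (fun u : ℝ => (1 + u) ^ (k - 1)) (Set.uIcc 0 1) := by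
      apply ContinuousOn.rpow_const (by fun_prop)
      intro x hx
      rw [Set.uIcc_of_le zero_le_one] at hx
      left; linarith [hx.1]
    refine (h1.mul_continuousOn h2).congr ?_
    intro u hu
    rw [Set.uIoc_of_le zero_le_one] at hu
    simp only
    rw [← Real.mul_rpow (by linarith [hu.2]) (by linarith [hu.1])]
    congr 1; ring
  have k2 := (key.comp_sub_left 0).symm
  simp only [zero_sub, even_two, Even.neg_pow, neg_zero, sub_zero] at k2
  exact k2.trans key

noncomputable def auxN (k : ℝ) (j : ℕ) : ℝ :=
  if Even j then Real.Gamma (k + 1/2) * (j.factorial : ℝ) /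
    (2 ^ j * ((j / 2).factorial : ℝ) * Real.Gamma ((j / 2 : ℕ) + (k + 1/2))) else 0

lemma aux_gamma_half (i : ℕ) : Real.Gamma (i + 1 / 2) =
    ((2 * i).factorial : ℝ) * √π / (4 ^ i * (i.factorial : ℝ)) := by
  induction i with
  | zero => simpa using Real.Gamma_one_half_eq
  | succ i ih =>
    rw [show ((i + 1 : ℕ) : ℝ) + 1 / 2 = (i + 1 / 2) + 1 by push_cast; ring,
      Real.Gamma_add_one (by positivity), ih, show 2 * (i + 1) = (2 * i + 1) + 1 by ring,
      Nat.factorial_succ, Nat.factorial_succ, Nat.factorial_succ]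
    push_cast
    have : (i.factorial : ℝ) ≠ 0 := by positivity
    field_simp
    ring

lemma aux_moment (k : ℝ) (hk : 0 < k) (j : ℕ) :
    (Real.Gamma (k + 1 / 2) / (√π * Real.Gamma k)) *
      ∫ u in (-1:ℝ)..1, u ^ j * (1 - u ^ 2) ^ (k - 1) = auxN k j := by
  have hneg : ∫ u in (-1:ℝ)..1, u ^ j * (1 - u ^ 2) ^ (k - 1) =
      ∫ u in (-1:ℝ)..1, (-u) ^ j * (1 - u ^ 2) ^ (k - 1) := by
    have := intervalIntegral.integral_comp_neg (a := -1) (b := 1)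
      (fun u : ℝ => u ^ j * (1 - u ^ 2) ^ (k - 1))
    simp only [even_two, Even.neg_pow, neg_neg] at this
    exact this.symm
  unfold auxN
  split_ifs with hj
  · obtain ⟨i, rfl⟩ := hj.two_dvd
    have hint : IntervalIntegrable (fun u : ℝ => u ^ (2 * i) * (1 - u ^ 2) ^ (k - 1))
        MeasureTheory.volume (-1) 1 :=
      (aux_intble k hk).continuousOn_mul (by fun_prop)
    have hm : ∫ u in (-1:ℝ)..0, u ^ (2 * i) * (1 - u ^ 2) ^ (k - 1) =
        ∫ u in (0:ℝ)..1, u ^ (2 * i) * (1 - u ^ 2) ^ (k - 1) := by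
      have := intervalIntegral.integral_comp_neg (a := 0) (b := 1)
        (fun u : ℝ => u ^ (2 * i) * (1 - u ^ 2) ^ (k - 1))
      simp only [even_two, Even.neg_pow, neg_zero, Even.mul_right] at this
      exact this.symm
    rw [← intervalIntegral.integral_add_adjacent_intervals (b := 0)
      (hint.mono_set (by
        rw [Set.uIcc_of_le (by norm_num), Set.uIcc_of_le (by norm_num)]
        exact Set.Icc_subset_Icc_right (by norm_num)))
      (hint.mono_set (by
        rw [Set.uIcc_of_le (by norm_num), Set.uIcc_of_le (by norm_num)]
        exact Set.Icc_subset_Icc_left (by norm_num))), hm, aux_half k hk, aux_gamma_half]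
    have h1 := (Real.Gamma_pos_of_pos hk).ne'
    have h2 := (Real.Gamma_pos_of_pos (show 0 < (i:ℝ) + (k + 1/2) by positivity)).ne'
    have h3 : √π ≠ 0 := by positivity
    have h4 : (i.factorial : ℝ) ≠ 0 := by positivity
    rw [Nat.mul_div_cancel_left _ two_pos, pow_mul]
    norm_num only
    field_simp
    norm_num
  · rw [Nat.not_even_iff_odd] at hj
    simp only [hj.neg_pow, neg_mul, intervalIntegral.integral_neg] at hneg
    rw [show ∫ u in (-1:ℝ)..1, u ^ j * (1 - u ^ 2) ^ (k - 1) = 0 by linarith, mul_zero]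

noncomputable def auxE (k : ℝ) (m : ℕ) : ℝ :=
  Real.Gamma (k + 1/2) / (4 ^ m * (m.factorial : ℝ) * Real.Gamma (m + (k + 1/2)))

open Finset in
lemma aux_trinomial (X Z Y : ℝ) (m : ℕ) :
    (X + (Z + Y)) ^ m = ∑ s ∈ antidiagonal m, ∑ t ∈ antidiagonal s.2,
      (m.factorial : ℝ) / ((s.1.factorial : ℝ) * (t.1.factorial : ℝ) * (t.2.factorial : ℝ)) *
        (X ^ s.1 * Z ^ t.1 * Y ^ t.2) := by
  have hch : ∀ n : ℕ, ∀ s ∈ antidiagonal n, (n.choose s.1 : ℝ) =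
      (n.factorial : ℝ) / ((s.1.factorial : ℝ) * (s.2.factorial : ℝ)) := by
    intro n s hs
    rw [HasAntidiagonal.mem_antidiagonal] at hs
    rw [← hs, Nat.cast_add_choose]
  rw [(Commute.all X (Z + Y)).add_pow']
  apply sum_congr rfl
  intro s hs
  rw [(Commute.all Z Y).add_pow', nsmul_eq_mul, hch m s hs, mul_sum, mul_sum]
  apply sum_congr rfl
  intro t ht
  rw [nsmul_eq_mul, hch _ t ht]
  have : (s.2.factorial : ℝ) ≠ 0 := by positivity
  field_simp

open Finset in
lemma aux_coeff (k : ℝ) (hk : 0 < k) (x y : ℝ) (m : ℕ) :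
    auxE k m * ∑ s ∈ antidiagonal m, ∑ t ∈ antidiagonal s.2,
      (m.factorial : ℝ) / ((s.1.factorial : ℝ) * (t.1.factorial : ℝ) * (t.2.factorial : ℝ)) *
        ((x ^ 2) ^ s.1 * (2 * x * y) ^ t.1 * (y ^ 2) ^ t.2) * auxN k t.1 =
    ∑ s ∈ antidiagonal m, (auxE k s.1 * x ^ (2 * s.1)) * (auxE k s.2 * y ^ (2 * s.2)) := by
  have hG : ∀ n : ℕ, Real.Gamma (n + (k + 1/2)) ≠ 0 := fun n =>
    (Real.Gamma_pos_of_pos (by positivity)).ne'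
  have hR : ∀ s ∈ antidiagonal m,
      (auxE k s.1 * x ^ (2 * s.1)) * (auxE k s.2 * y ^ (2 * s.2)) =
      ∑ t ∈ antidiagonal s.2, Real.Gamma (k + 1/2) ^ 2 / (4 ^ m * Real.Gamma (m + (k + 1/2))) *
        x ^ (2 * s.1) * y ^ (2 * s.2) / (s.1.factorial : ℝ) *
        ((s.1.choose t.1 : ℝ) / (Real.Gamma (t.1 + (k + 1/2)) * (t.2.factorial : ℝ))) := by
    intro s hs
    rw [HasAntidiagonal.mem_antidiagonal] at hs
    rw [← mul_sum, aux_vander _ (by positivity), hs, auxE, auxE, ← hs, pow_add]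
    have := hG (s.1 + s.2)
    have := hG s.1
    have := hG s.2
    have : (s.1.factorial : ℝ) ≠ 0 := by positivity
    have : (s.2.factorial : ℝ) ≠ 0 := by positivity
    field_simp
  rw [sum_congr rfl hR, mul_sum]
  simp_rw [mul_sum]
  rw [sum_sigma', sum_sigma']
  have hL : ∀ (A : Finset (Σ _ : ℕ × ℕ, ℕ × ℕ)) (f : (Σ _ : ℕ × ℕ, ℕ × ℕ) → ℝ)
      (P : (Σ _ : ℕ × ℕ, ℕ × ℕ) → Prop) [DecidablePred P],
      (∀ a ∈ A, ¬ P a → f a = 0) → ∑ a ∈ A, f a = ∑ a ∈ A with P a, f a := by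
    intro A f P _ h
    rw [sum_filter_of_ne]
    intro a ha hne
    by_contra hP
    exact hne (h a ha hP)
  rw [hL _ _ (fun a => Even a.2.1) (by
      rintro ⟨s, t⟩ _ h
      simp only at h
      simp [auxN, h]),
    hL (antidiagonal m |>.sigma fun a => antidiagonal a.2) _ (fun a => a.2.1 ≤ a.1.1) (by
      rintro ⟨s, t⟩ _ h
      simp only [not_le] at h
      simp [Nat.choose_eq_zero_of_lt h])]
  refine sum_nbij' (fun a => ⟨(a.1.1 + a.2.1 / 2, a.2.2 + a.2.1 / 2), (a.2.1 / 2, a.2.2)⟩)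
    (fun a => ⟨(a.1.1 - a.2.1, a.2.2 + 2 * a.2.1), (2 * a.2.1, a.2.2)⟩) ?_ ?_ ?_ ?_ ?_
  · rintro ⟨⟨p, t⟩, ⟨j, q⟩⟩ h
    simp only [mem_filter, mem_sigma, HasAntidiagonal.mem_antidiagonal] at h ⊢
    obtain ⟨⟨h1, h2⟩, i, rfl⟩ := h
    omega
  · rintro ⟨⟨p, t⟩, ⟨j, q⟩⟩ h
    simp only [mem_filter, mem_sigma, HasAntidiagonal.mem_antidiagonal] at h ⊢
    obtain ⟨⟨h1, h2⟩, h3⟩ := h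
    refine ⟨⟨by omega, by omega⟩, by simp⟩
  · rintro ⟨⟨p, t⟩, ⟨j, q⟩⟩ h
    simp only [mem_filter, mem_sigma, HasAntidiagonal.mem_antidiagonal] at h
    obtain ⟨⟨h1, h2⟩, i, rfl⟩ := h
    refine Sigma.ext (Prod.ext ?_ ?_) (heq_of_eq (Prod.ext ?_ ?_)) <;> dsimp only <;> omega
  · rintro ⟨⟨p, t⟩, ⟨j, q⟩⟩ h
    simp only [mem_filter, mem_sigma, HasAntidiagonal.mem_antidiagonal] at h
    obtain ⟨⟨h1, h2⟩, h3⟩ := h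
    refine Sigma.ext (Prod.ext ?_ ?_) (heq_of_eq (Prod.ext ?_ ?_)) <;> dsimp only <;> omega
  · rintro ⟨⟨p, t⟩, ⟨j, q⟩⟩ h
    simp only [mem_filter, mem_sigma, HasAntidiagonal.mem_antidiagonal] at h
    obtain ⟨⟨h1, h2⟩, h3⟩ := h
    obtain ⟨i, rfl⟩ := h3.two_dvd
    simp only [Nat.mul_div_cancel_left _ two_pos]
    rw [auxN, if_pos h3, auxE, Nat.mul_div_cancel_left _ two_pos, add_comm p i, Nat.cast_add_choose]
    have := hG m
    have := hG i
    have : (m.factorial : ℝ) ≠ 0 := by positivity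
    have : (p.factorial : ℝ) ≠ 0 := by positivity
    have : (i.factorial : ℝ) ≠ 0 := by positivity
    have : (q.factorial : ℝ) ≠ 0 := by positivity
    have : ((i + p).factorial : ℝ) ≠ 0 := by positivity
    have : ((2 * i).factorial : ℝ) ≠ 0 := by positivity
    rw [show (2 * x * y) ^ (2 * i) = 2 ^ (2 * i) * x ^ (2 * i) * y ^ (2 * i) by
      rw [mul_pow, mul_pow], mul_add, mul_add, pow_add, pow_add, pow_mul, pow_mul, pow_mul, pow_mul]
    field_simp
    rw [pow_mul y]

lemma aux_summable (k : ℝ) (hk : 0 < k) (A : ℝ) (hA : 0 ≤ A) :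
    Summable (fun m : ℕ => auxE k m * A ^ m) := by
  have hb : ∀ m : ℕ, Real.Gamma (k + 1/2) * (1/2) ^ m ≤ Real.Gamma (m + (k + 1/2)) := by
    intro m
    induction m with
    | zero => simp
    | succ n ih =>
      rw [show ((n + 1 : ℕ) : ℝ) + (k + 1/2) = (n + (k + 1/2)) + 1 by push_cast; ring,
        Real.Gamma_add_one (by positivity), pow_succ, ← mul_assoc, mul_comm]
      apply mul_le_mul _ ih _ (by positivity)
      · have : (0:ℝ) ≤ n := by positivity
        linarith
      · have := (Real.Gamma_pos_of_pos (show 0 < k + 1/2 by positivity))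
        positivity
  have h0 := (Real.Gamma_pos_of_pos (show 0 < k + 1/2 by positivity))
  refine Summable.of_nonneg_of_le (fun m => ?_) (fun m => ?_) (Real.summable_pow_div_factorial (A / 2))
  · have := (Real.Gamma_pos_of_pos (show 0 < (m:ℝ) + (k + 1/2) by positivity))
    unfold auxE; positivity
  · have hm := (Real.Gamma_pos_of_pos (show 0 < (m:ℝ) + (k + 1/2) by positivity))
    have : auxE k m ≤ (1 / 2) ^ m / (m.factorial : ℝ) := by
      unfold auxE
      rw [div_le_div_iff₀ (by positivity) (by positivity)]
      calc Real.Gamma (k + 1/2) * (m.factorial : ℝ)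
          = (Real.Gamma (k + 1/2) * (1/2) ^ m) * (2 ^ m * (m.factorial : ℝ)) := by
            rw [one_div, inv_pow]; field_simp
        _ ≤ Real.Gamma (m + (k + 1/2)) * (2 ^ m * (m.factorial : ℝ)) := by gcongr; exact hb m
        _ = _ := by
            rw [show (4:ℝ) = 2 * 2 by norm_num, mul_pow, one_div, inv_pow]; field_simp
    calc auxE k m * A ^ m ≤ (1 / 2) ^ m / (m.factorial : ℝ) * A ^ m := by gcongr
      _ = _ := by rw [div_eq_mul_one_div A, mul_pow]; ring

lemma aux_bessel (k t : ℝ) : besselI (k - 1 / 2) t = ∑' m : ℕ, auxE k m * t ^ (2 * m) := by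
  unfold besselI auxE
  rw [← tsum_mul_left]
  congr 1; ext m
  rw [show k - 1 / 2 + 1 = k + 1 / 2 by ring, show (m:ℝ) + (k - 1 / 2) + 1 = m + (k + 1 / 2) by ring,
    div_pow, pow_mul 2 2 m]
  norm_num only
  field_simp

lemma aux_nonneg (k : ℝ) (hk : 0 < k) (m : ℕ) : 0 ≤ auxE k m := by
  have := (Real.Gamma_pos_of_pos (show 0 < (m:ℝ) + (k + 1/2) by positivity))
  have := (Real.Gamma_pos_of_pos (show 0 < k + 1/2 by positivity))
  unfold auxE; positivity

lemma aux_R (x y u : ℝ) (h1 : -1 ≤ u) (h2 : u ≤ 1) :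
    0 ≤ x ^ 2 + y ^ 2 + 2 * u * x * y ∧ x ^ 2 + y ^ 2 + 2 * u * x * y ≤ 2 * (x ^ 2 + y ^ 2) := by
  constructor
  · nlinarith [mul_nonneg (by linarith : 0 ≤ 1 + u) (sq_nonneg (x + y)),
      mul_nonneg (by linarith : 0 ≤ 1 - u) (sq_nonneg (x - y))]
  · nlinarith [mul_nonneg (by linarith : 0 ≤ 1 + u) (sq_nonneg (x - y)),
      mul_nonneg (by linarith : 0 ≤ 1 - u) (sq_nonneg (x + y))]

open MeasureTheory in
lemma aux_interchange (k : ℝ) (hk : 0 < k) (x y : ℝ) :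
    HasSum (fun m : ℕ => ∫ u in (-1 : ℝ)..1,
        auxE k m * (x ^ 2 + y ^ 2 + 2 * u * x * y) ^ m * (1 - u ^ 2) ^ (k - 1))
      (∫ u in (-1 : ℝ)..1, besselI (k - 1 / 2) (√(x ^ 2 + y ^ 2 + 2 * u * x * y)) *
            (1 - u ^ 2) ^ (k - 1)) := by
  have hw := aux_intble k hk
  have hw0 : ∀ u : ℝ, u ∈ Set.uIoc (-1 : ℝ) 1 → 0 ≤ (1 - u ^ 2) ^ (k - 1) ∧ -1 ≤ u ∧ u ≤ 1 := by
    intro u hu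
    rw [Set.uIoc_of_le (by norm_num)] at hu
    refine ⟨Real.rpow_nonneg (by nlinarith [hu.1, hu.2]) _, hu.1.le, hu.2⟩
  have hs := aux_summable k hk (2 * (x ^ 2 + y ^ 2)) (by positivity)
  refine intervalIntegral.hasSum_integral_of_dominated_convergence
    (fun m u => auxE k m * (2 * (x ^ 2 + y ^ 2)) ^ m * (1 - u ^ 2) ^ (k - 1)) ?_ ?_ ?_ ?_ ?_
  · intro m
    have := (hw.continuousOn_mul (g := fun u => auxE k m * (x ^ 2 + y ^ 2 + 2 * u * x * y) ^ m)
      (by fun_prop))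
    exact this.aestronglyMeasurable_restrict_uIoc
  · intro m
    filter_upwards with u hu
    obtain ⟨h0, h1, h2⟩ := hw0 u hu
    obtain ⟨h3, h4⟩ := aux_R x y u h1 h2
    have := aux_nonneg k hk m
    rw [Real.norm_of_nonneg (by positivity)]
    gcongr
  · filter_upwards with u hu
    exact hs.mul_right _
  · simp_rw [tsum_mul_right]
    exact hw.const_mul _
  · filter_upwards with u hu
    obtain ⟨h0, h1, h2⟩ := hw0 u hu
    obtain ⟨h3, h4⟩ := aux_R x y u h1 h2
    rw [aux_bessel]
    have h5 : ∀ n : ℕ, √(x ^ 2 + y ^ 2 + 2 * u * x * y) ^ (2 * n) =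
        (x ^ 2 + y ^ 2 + 2 * u * x * y) ^ n := fun n => by rw [pow_mul, Real.sq_sqrt h3]
    simp_rw [h5]
    exact (aux_summable k hk _ h3).hasSum.mul_right _

open Finset in
lemma aux_term (k : ℝ) (hk : 0 < k) (x y : ℝ) (m : ℕ) :
    (Real.Gamma (k + 1 / 2) / (√π * Real.Gamma k)) * ∫ u in (-1 : ℝ)..1,
        auxE k m * (x ^ 2 + y ^ 2 + 2 * u * x * y) ^ m * (1 - u ^ 2) ^ (k - 1) =
    ∑ s ∈ antidiagonal m, (auxE k s.1 * x ^ (2 * s.1)) * (auxE k s.2 * y ^ (2 * s.2)) := by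
  rw [← aux_coeff k hk]
  have e : ∀ u : ℝ, auxE k m * (x ^ 2 + y ^ 2 + 2 * u * x * y) ^ m * (1 - u ^ 2) ^ (k - 1) =
      auxE k m * ∑ s ∈ antidiagonal m, ∑ t ∈ antidiagonal s.2,
      (m.factorial : ℝ) / ((s.1.factorial : ℝ) * (t.1.factorial : ℝ) * (t.2.factorial : ℝ)) *
        ((x ^ 2) ^ s.1 * (2 * x * y) ^ t.1 * (y ^ 2) ^ t.2) *
          (u ^ t.1 * (1 - u ^ 2) ^ (k - 1)) := by
    intro u
    rw [show x ^ 2 + y ^ 2 + 2 * u * x * y = x ^ 2 + (u * (2 * x * y) + y ^ 2) by ring,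
      aux_trinomial, mul_assoc, sum_mul]
    congr 1
    refine sum_congr rfl fun s _ => ?_
    rw [sum_mul]
    refine sum_congr rfl fun t _ => ?_
    rw [mul_pow u]; ring
  have hint : ∀ j : ℕ, IntervalIntegrable (fun u : ℝ => u ^ j * (1 - u ^ 2) ^ (k - 1))
      MeasureTheory.volume (-1) 1 := fun j =>
    (aux_intble k hk).continuousOn_mul (by fun_prop)
  simp_rw [e]
  rw [intervalIntegral.integral_const_mul, intervalIntegral.integral_finsetSum]
  · rw [mul_left_comm]
    congr 1
    rw [mul_sum]
    refine sum_congr rfl fun s _ => ?_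
    rw [intervalIntegral.integral_finsetSum]
    · rw [mul_sum]
      refine sum_congr rfl fun t _ => ?_
      rw [intervalIntegral.integral_const_mul, ← aux_moment k hk]
      ring
    · intro t _
      exact (hint _).const_mul _
  · intro s _
    have := IntervalIntegrable.sum (antidiagonal s.2) (fun t _ => (hint t.1).const_mul
      ((m.factorial : ℝ) / ((s.1.factorial : ℝ) * (t.1.factorial : ℝ) * (t.2.factorial : ℝ)) *
        ((x ^ 2) ^ s.1 * (2 * x * y) ^ t.1 * (y ^ 2) ^ t.2)))
    refine this.congr ?_
    intro u _
    simp

/-- Product formula for the normalized modified Bessel function. -/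
theorem bessel_product_formula (k : ℝ) (hk : 0 < k) (x y : ℝ) :
    besselI (k - 1 / 2) x * besselI (k - 1 / 2) y =
      (Real.Gamma (k + 1 / 2) / (Real.sqrt Real.pi * Real.Gamma k)) *
        ∫ u in (-1 : ℝ)..1,
          besselI (k - 1 / 2) (Real.sqrt (x ^ 2 + y ^ 2 + 2 * u * x * y)) *
            (1 - u ^ 2) ^ (k - 1) := by
  have h := (aux_interchange k hk x y).mul_left
    (Real.Gamma (k + 1 / 2) / (Real.sqrt Real.pi * Real.Gamma k))
  simp_rw [aux_term k hk] at h
  rw [← h.tsum_eq, aux_bessel, aux_bessel]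
  have hs : ∀ z : ℝ, Summable (fun m : ℕ => ‖auxE k m * z ^ (2 * m)‖) := by
    intro z
    have := aux_summable k hk (z ^ 2) (by positivity)
    simp_rw [← pow_mul] at this
    exact this.norm
  exact tsum_mul_tsum_eq_tsum_sum_antidiagonal_of_summable_norm (hs x) (hs y)
end
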